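/- For every p ∈ [1,∞) and α ∈ (0,1) there exist constants K, C ∈ (0,∞) (K depending only on p and α, C only on α) such that for every real normed space X, every n ∈ ℕ, and every function f : {-1,1}^n → X: ‖f − ∫_{{-1,1}^n} f dμ_α^n‖_{L_p(log L)^{p/2}(μ_α^n;X)} ≤ K · ( ∫_{{-1,1}^n} ‖Σ_{i=1}^n δ_i ∂_i^α f‖_{L_p(μ_α^n;X)}^p dσ_n(δ) )^{1/p} + C·(log n + 1) · ∫_{{-1,1}^n} ‖Σ_{i=1}^n δ_i ∂_i^α f‖_{L_1(μ_α^n;X)} dσ_n(δ). -/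

import Mathlib

open Finset

noncomputable section

/-- The real sign of a Boolean coordinate: `true ↦ 1`, `false ↦ -1`. -/
def sgn (b : Bool) : ℝ := if b then 1 else -1

/-- Hamming distance on the discrete cube `{-1,1}^n ≃ Bool^n`. -/
def hamming {n : ℕ} (x y : Fin n → Bool) : ℕ :=
  (Finset.univ.filter fun i => x i ≠ y i).card

/-- Flip the `i`-th coordinate. -/
def flipc {ι : Type*} [DecidableEq ι] (x : ι → Bool) (i : ι) : ι → Bool :=
  Function.update x i (!(x i))

/-- Negate all coordinates (the antipodal map). -/
def negc {ι : Type*} (x : ι → Bool) : ι → Bool := fun i => !(x i)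

/-- `X` has Rademacher type `p` with constant `T`. -/
def RademacherType (X : Type*) [NormedAddCommGroup X] [NormedSpace ℝ X] (p T : ℝ) : Prop :=
  ∀ (m : ℕ) (v : Fin m → X),
    (2 ^ m : ℝ)⁻¹ * ∑ x : Fin m → Bool, ‖∑ i, sgn (x i) • v i‖ ^ p ≤
      T ^ p * ∑ i, ‖v i‖ ^ p

/-- `X` has cotype `q` with constant `Cq`. -/
def CotypeC (X : Type*) [NormedAddCommGroup X] [NormedSpace ℝ X] (q Cq : ℝ) : Prop :=
  ∀ (m : ℕ) (v : Fin m → X),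
    (∑ i, ‖v i‖ ^ q) / Cq ^ q ≤
      (2 ^ m : ℝ)⁻¹ * ∑ x : Fin m → Bool, ‖∑ i, sgn (x i) • v i‖ ^ q

open scoped Classical in
/-- The weak `ℓ_p` norm of a finite real vector. -/
def weakLp {ι : Type*} [Fintype ι] (p : ℝ) (w : ι → ℝ) : ℝ :=
  sSup {z | ∃ r : ℝ, 0 ≤ r ∧
    z = r * ((Finset.univ.filter fun i => r ≤ |w i|).card : ℝ) ^ (1 / p)}

/-- Metric stable type `p` with constant `S`. -/
def MetricStableType (M : Type*) [PseudoMetricSpace M] (p S : ℝ) : Prop :=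
  ∀ (n : ℕ) (f : (Fin n → Bool) → M),
    (2 ^ n : ℝ)⁻¹ * ∑ x : Fin n → Bool, dist (f x) (f (negc x)) ^ p ≤
      S ^ p * ((2 ^ n : ℝ)⁻¹ *
        ∑ x : Fin n → Bool, weakLp p (fun i => (1 / 2) * dist (f x) (f (flipc x i))) ^ p)

/-- The product biased measure weight of a point of the cube. -/
def biasedWeight {ι : Type*} [Fintype ι] (α : ι → ℝ) (x : ι → Bool) : ℝ :=
  ∏ i, if x i then α i else 1 - α i

/-- The biased discrete partial derivative `∂_i^α`. -/
def bder {ι : Type*} [DecidableEq ι] {X : Type*} [AddCommGroup X] [Module ℝ X]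
    (α : ℝ) (i : ι) (f : (ι → Bool) → X) (x : ι → Bool) : X :=
  f x - (α • f (Function.update x i true) + (1 - α) • f (Function.update x i false))

/-- The `L_p(μ; X)` norm with respect to the weight `μ` on the cube. -/
def lpNormW {ι : Type*} [Fintype ι] [DecidableEq ι] {X : Type*} [NormedAddCommGroup X]
    (μ : (ι → Bool) → ℝ) (p : ℝ) (g : (ι → Bool) → X) : ℝ :=
  (∑ x : ι → Bool, μ x * ‖g x‖ ^ p) ^ (1 / p)

/-- The Orlicz `L_p(log L)^{p/2}(μ; X)` norm with respect to the weight `μ` on the cube. -/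
def orliczNormW {ι : Type*} [Fintype ι] [DecidableEq ι] {X : Type*} [NormedAddCommGroup X]
    (μ : (ι → Bool) → ℝ) (p : ℝ) (g : (ι → Bool) → X) : ℝ :=
  sInf {γ : ℝ | 0 < γ ∧
    ∑ x : ι → Bool, (μ x * (‖g x‖ ^ p / γ ^ p)) *
      Real.log (Real.exp 1 + ‖g x‖ ^ p / γ ^ p) ^ (p / 2) ≤ 1}

/-- The one-dimensional transition kernel `p_t^α`. -/
def ptrans (t α : ℝ) : Bool → Bool → ℝ := fun a b =>
  match a, b with
  | true, true => 1 - (1 - Real.exp (-t)) * (1 - α)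
  | true, false => (1 - Real.exp (-t)) * (1 - α)
  | false, true => (1 - Real.exp (-t)) * α
  | false, false => 1 - (1 - Real.exp (-t)) * α

/-- The matrix `η_t^α(·,·;θ)`. -/
def eta (t α θ : ℝ) : Bool → Bool → ℝ := fun a b =>
  match a, b with
  | true, true => (Real.exp (-t) - θ) / ptrans t α true true
  | true, false => (-θ) / ptrans t α false true
  | false, true => (θ - Real.exp (-t)) / ptrans t α true false
  | false, false => θ / ptrans t α false false

/-- The product transition kernel `p_t^𝛂`. -/
def pprod {n : ℕ} (t : ℝ) (α : Fin n → ℝ) (x y : Fin n → Bool) : ℝ :=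
  ∏ i, ptrans t (α i) (x i) (y i)

/-- Glue coordinates on `σ` (given by `x`) with coordinates off `σ` (given by `w`). -/
def glue {n : ℕ} (σ : Finset (Fin n)) (x : {i // i ∈ σ} → Bool) (w : Fin n → Bool) :
    Fin n → Bool := fun j => if h : j ∈ σ then x ⟨j, h⟩ else w j

/-- The low-dimensional skeleton `𝒞_d^n` of the solid cube `[-1,1]^n`. -/
def cubeSkeleton (n d : ℕ) : Set (Fin n → ℝ) :=
  {x | (∀ i, |x i| ≤ 1) ∧ n - d ≤ {i | |x i| = 1}.ncard}

/-- The `ℓ_p^d` norm on `ℝ^d`. -/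
def lpnorm (p : ℝ) {d : ℕ} (v : Fin d → ℝ) : ℝ := (∑ k, |v k| ^ p) ^ (1 / p)

/-- The isoperimetric profile `t √(log (e / t))` on `[0, 1]`. -/
def logProfile (t : ℝ) : ℝ := t * √(1 - Real.log t)

lemma logProfile_nonneg {t : ℝ} (ht : 0 ≤ t) : 0 ≤ logProfile t :=
  mul_nonneg ht (Real.sqrt_nonneg _)

lemma sq_logProfile {t : ℝ} (h0 : 0 ≤ t) (h1 : t ≤ 1) :
    logProfile t ^ 2 = t ^ 2 * (1 - Real.log t) := by
  rw [logProfile, mul_pow, Real.sq_sqrt]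
  linarith [Real.log_nonpos h0 h1]

lemma continuousOn_logProfile : ContinuousOn logProfile (Set.Ici 0) := by
  have h : Continuous fun t : ℝ => √(t ^ 2 - t * (t * Real.log t)) :=
    ((continuous_id.pow 2).sub (continuous_id.mul Real.continuous_mul_log)).sqrt
  refine h.continuousOn.congr fun t ht => ?_
  have ht' : (0 : ℝ) ≤ t := ht
  beta_reduce
  rw [logProfile, show t ^ 2 - t * (t * Real.log t) = t ^ 2 * (1 - Real.log t) by ring,
    Real.sqrt_mul (sq_nonneg t), Real.sqrt_sq ht']

lemma hasDerivAt_logProfile {t : ℝ} (h0 : 0 < t) (h1 : t ≤ 1) :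
    HasDerivAt logProfile (√(1 - Real.log t) - 1 / (2 * √(1 - Real.log t))) t := by
  have hl : (0 : ℝ) < 1 - Real.log t := by linarith [Real.log_nonpos h0.le h1]
  have h := (hasDerivAt_id t).mul (((Real.hasDerivAt_log h0.ne').const_sub 1).sqrt hl.ne')
  refine h.congr_deriv ?_
  have := (Real.sqrt_pos.2 hl).ne'
  simp only [id]
  field_simp
  ring

lemma logProfile_two_point_aux {α b d K : ℝ} (hα0 : 0 < α) (hα1 : α < 1) (hb : 0 ≤ b)
    (hd : 0 ≤ d) (hbd : b + d ≤ 1) (hK : (1 - α) / α ≤ K ^ 2) :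
    ((logProfile (b + α * d) - (1 - α) * logProfile b) / α) ^ 2 ≤
      logProfile (b + d) ^ 2 + K ^ 2 * d ^ 2 := by
  set F : ℝ → ℝ := fun s =>
    ((logProfile (b + α * s) - (1 - α) * logProfile b) / α) ^ 2 -
      (b + s) ^ 2 * (1 - Real.log (b + s)) - K ^ 2 * s ^ 2 with hF
  have hcont : ContinuousOn F (Set.Icc 0 d) := by
    have e1 : ContinuousOn (fun s : ℝ => logProfile (b + α * s)) (Set.Icc 0 d) :=
      continuousOn_logProfile.comp (by fun_prop) fun s hs => by
        have := mul_nonneg hα0.le hs.1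
        exact Set.mem_Ici.2 (by linarith)
    have e2 : Continuous fun s : ℝ => (b + s) ^ 2 * (1 - Real.log (b + s)) := by
      have : (fun s : ℝ => (b + s) ^ 2 * (1 - Real.log (b + s))) =
          fun s => (b + s) ^ 2 - (b + s) * ((b + s) * Real.log (b + s)) := by
        ext s; ring
      rw [this]
      have := Real.continuous_mul_log.comp
        (continuous_const.add continuous_id : Continuous fun s : ℝ => b + s)
      simp only [Function.comp_def] at this
      fun_prop
    have e3 := e2.continuousOn (s := Set.Icc 0 d)
    fun_prop
  have hder : ∀ s ∈ interior (Set.Icc 0 d), HasDerivAt F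
      (2 * ((logProfile (b + α * s) - (1 - α) * logProfile b) / α) *
        (√(1 - Real.log (b + α * s)) - 1 / (2 * √(1 - Real.log (b + α * s)))) -
        (2 * (b + s) * (1 - Real.log (b + s)) - (b + s)) - 2 * K ^ 2 * s) s := by
    intro s hs
    rw [interior_Icc] at hs
    have hs0 : 0 < s := hs.1
    have hs1 : s < d := hs.2
    have hp := mul_pos hα0 hs0
    have hp' : α * s < s := by nlinarith
    have d1 := (hasDerivAt_logProfile (t := b + α * s) (by linarith) (by linarith)).comp s
      (((hasDerivAt_id s).const_mul α).const_add b)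
    have d2 := (((d1.sub_const ((1 - α) * logProfile b)).div_const α).pow 2)
    have d3 := (hasDerivAt_id s).const_add b
    have d4 := (d3.pow 2).mul ((d3.log (by simp; linarith)).const_sub 1)
    have d5 := ((hasDerivAt_id s).pow 2).const_mul (K ^ 2)
    refine ((d2.sub d4).sub d5).congr_deriv ?_
    have : b + s ≠ 0 := by linarith
    have hα := hα0.ne'
    simp only [Function.comp_def, id, Pi.pow_apply, Nat.cast_ofNat, Nat.add_one_sub_one, pow_one]
    generalize √(1 - Real.log (b + α * s)) - 1 / (2 * √(1 - Real.log (b + α * s))) = J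
    field_simp
    ring
  have hanti : AntitoneOn F (Set.Icc 0 d) := by
    refine antitoneOn_of_deriv_nonpos (convex_Icc 0 d) hcont
      (fun s hs => (hder s hs).differentiableAt.differentiableWithinAt) fun s hs => ?_
    rw [(hder s hs).deriv]
    rw [interior_Icc] at hs
    have hs0 : 0 < s := hs.1
    have hs1 : s < d := hs.2
    have hp := mul_pos hα0 hs0
    have hp' : α * s < s := by nlinarith
    set x := b + α * s with hx
    have hx0 : 0 < x := by linarith
    have hx1 : x ≤ 1 := by linarith
    have hlx : 1 ≤ 1 - Real.log x := by linarith [Real.log_nonpos hx0.le hx1]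
    set l := √(1 - Real.log x) with hl
    have hl1 : 1 ≤ l := Real.one_le_sqrt.2 hlx
    have hl2 : l ^ 2 = 1 - Real.log x := Real.sq_sqrt (by linarith)
    have hD : (logProfile x - (1 - α) * logProfile b) / α ≤ (b + s) * l := by
      rw [div_le_iff₀ hα0]
      have : b * l ≤ logProfile b := by
        rcases hb.eq_or_lt with h | h
        · rw [← h]; simp [logProfile]
        · refine mul_le_mul_of_nonneg_left (Real.sqrt_le_sqrt ?_) hb
          linarith [Real.log_le_log h (show b ≤ x by linarith)]
      have h2 : logProfile x = x * l := rfl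
      rw [h2]
      nlinarith [mul_le_mul_of_nonneg_left this (show 0 ≤ 1 - α by linarith)]
    have hJ : 0 ≤ l - 1 / (2 * l) := by
      have : 1 / (2 * l) ≤ 1 / 2 := by
        apply one_div_le_one_div_of_le <;> linarith
      linarith
    have h1 := mul_le_mul_of_nonneg_right hD hJ
    have h2 : (b + s) * l * (l - 1 / (2 * l)) = (b + s) * (1 - Real.log x - 1 / 2) := by
      rw [← hl2]
      have : l ≠ 0 := by linarith
      field_simp
    have h3 : Real.log (b + s) - Real.log x ≤ (1 - α) * s / x := by
      rw [← Real.log_div (by linarith) hx0.ne']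
      refine (Real.log_le_sub_one_of_pos (div_pos (by linarith) hx0)).trans (le_of_eq ?_)
      rw [hx] at hx0 ⊢
      field_simp
      ring
    have h4 : (b + s) * ((1 - α) * s / x) ≤ K ^ 2 * s := by
      refine le_trans ?_ (mul_le_mul_of_nonneg_right hK hs0.le)
      rw [mul_div_assoc', div_mul_eq_mul_div, div_le_div_iff₀ hx0 hα0]
      have : α * (b + s) ≤ x := by nlinarith
      nlinarith [mul_le_mul_of_nonneg_right this (mul_nonneg (show 0 ≤ 1 - α by linarith) hs0.le)]
    have h5 := mul_le_mul_of_nonneg_left h3 (show 0 ≤ b + s by linarith)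
    nlinarith
  have h := hanti (Set.left_mem_Icc.2 hd) (Set.right_mem_Icc.2 hd) hd
  have h0 : F 0 = 0 := by
    have := sq_logProfile hb (by linarith)
    simp only [hF, mul_zero, add_zero]
    rw [← this]
    field_simp
    ring
  rw [h0] at h
  simp only [hF] at h
  rw [sq_logProfile (by linarith) hbd]
  linarith

lemma logProfile_two_point {α a b K : ℝ} (hα0 : 0 < α) (hα1 : α < 1) (hb : 0 ≤ b)
    (hba : b ≤ a) (ha : a ≤ 1) (hK : (1 - α) / α ≤ K ^ 2) :
    logProfile (α * a + (1 - α) * b) ≤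
      α * √(logProfile a ^ 2 + K ^ 2 * (a - b) ^ 2) + (1 - α) * logProfile b := by
  have h := logProfile_two_point_aux (d := a - b) hα0 hα1 hb (by linarith) (by linarith) hK
  have h' := Real.le_sqrt_of_sq_le h
  rw [div_le_iff₀ hα0] at h'
  rw [show b + α * (a - b) = α * a + (1 - α) * b by ring, add_sub_cancel] at h'
  linarith

/-- The Euclidean norm of the positive parts of the coordinate increments of `g`. -/
def upGrad {n : ℕ} (g : (Fin n → Bool) → ℝ) (x : Fin n → Bool) : ℝ :=
  √(∑ i, max (g x - g (flipc x i)) 0 ^ 2)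

lemma sum_cube_succ {M : Type*} [AddCommMonoid M] {n : ℕ} (F : (Fin (n + 1) → Bool) → M) :
    ∑ x, F x =
      ∑ y : Fin n → Bool, F (Fin.cons true y) + ∑ y : Fin n → Bool, F (Fin.cons false y) := by
  rw [← (Fin.consEquiv fun _ => Bool).sum_comp, Fintype.sum_prod_type, Fintype.sum_bool]
  rfl

lemma flipc_cons_zero {n : ℕ} (b : Bool) (y : Fin n → Bool) :
    flipc (Fin.cons b y : Fin (n + 1) → Bool) 0 = Fin.cons (!b) y := by
  simp [flipc, Fin.update_cons_zero]

lemma flipc_cons_succ {n : ℕ} (b : Bool) (y : Fin n → Bool) (i : Fin n) :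
    flipc (Fin.cons b y : Fin (n + 1) → Bool) i.succ = Fin.cons b (flipc y i) := by
  simp [flipc, Fin.cons_update]

lemma biasedWeight_cons {n : ℕ} (α : ℝ) (b : Bool) (y : Fin n → Bool) :
    biasedWeight (fun _ => α) (Fin.cons b y : Fin (n + 1) → Bool) =
      (if b then α else 1 - α) * biasedWeight (fun _ => α) y := by
  simp [biasedWeight, Fin.prod_univ_succ]

lemma biasedWeight_pos {n : ℕ} {α : ℝ} (hα0 : 0 < α) (hα1 : α < 1) (x : Fin n → Bool) :
    0 < biasedWeight (fun _ => α) x :=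
  Finset.prod_pos fun i _ => by split_ifs <;> linarith

lemma sum_biasedWeight (n : ℕ) (α : ℝ) :
    ∑ x : Fin n → Bool, biasedWeight (fun _ => α) x = 1 := by
  induction n with
  | zero => simp [biasedWeight]
  | succ n ih =>
    rw [sum_cube_succ]
    simp only [biasedWeight_cons, ← Finset.mul_sum, ih]
    simp

lemma sqrt_sq_add_sq_sum_le {ι : Type*} [Fintype ι] (w A B : ι → ℝ) (hw : ∀ x, 0 ≤ w x) :
    √((∑ x, w x * A x) ^ 2 + (∑ x, w x * B x) ^ 2) ≤ ∑ x, w x * √(A x ^ 2 + B x ^ 2) := by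
  simp only [← Complex.norm_add_mul_I]
  have h : ((∑ x, w x * A x : ℝ) : ℂ) + ((∑ x, w x * B x : ℝ) : ℂ) * Complex.I =
      ∑ x, (w x : ℂ) * (A x + B x * Complex.I) := by
    push_cast
    rw [Finset.sum_mul, ← Finset.sum_add_distrib]
    exact Finset.sum_congr rfl fun x _ => by ring
  rw [h]
  refine (norm_sum_le _ _).trans (Finset.sum_le_sum fun x _ => le_of_eq ?_)
  rw [norm_mul, Complex.norm_real, Real.norm_of_nonneg (hw x)]

lemma upGrad_nonneg {n : ℕ} (g : (Fin n → Bool) → ℝ) (x : Fin n → Bool) : 0 ≤ upGrad g x :=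
  Real.sqrt_nonneg _

lemma sq_upGrad {n : ℕ} (g : (Fin n → Bool) → ℝ) (x : Fin n → Bool) :
    upGrad g x ^ 2 = ∑ i, max (g x - g (flipc x i)) 0 ^ 2 :=
  Real.sq_sqrt (Finset.sum_nonneg fun _ _ => sq_nonneg _)

/-- A one-sided functional isoperimetric inequality of Bobkov type on the biased cube. -/
lemma logProfile_sum_le_sum_sqrt {α K : ℝ} (hα0 : 0 < α) (hα1 : α < 1)
    (hK : (1 - α) / α ≤ K ^ 2) (hK' : α / (1 - α) ≤ K ^ 2) (n : ℕ)
    (g : (Fin n → Bool) → ℝ) (h0 : ∀ x, 0 ≤ g x) (h1 : ∀ x, g x ≤ 1) :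
    logProfile (∑ x, biasedWeight (fun _ => α) x * g x) ≤
      ∑ x, biasedWeight (fun _ => α) x * √(logProfile (g x) ^ 2 + K ^ 2 * upGrad g x ^ 2) := by
  induction n with
  | zero =>
    simp only [biasedWeight, upGrad, Fintype.sum_unique, Finset.univ_eq_empty,
      Finset.prod_empty, Finset.sum_empty, one_mul, Real.sqrt_zero]
    norm_num
    rw [Real.sqrt_sq (logProfile_nonneg (h0 _))]
  | succ n ih =>
    set w : (Fin n → Bool) → ℝ := biasedWeight fun _ => α with hw
    have hwpos : ∀ y, 0 ≤ w y := fun y => (biasedWeight_pos hα0 hα1 y).le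
    have hw1 : ∑ y, w y = 1 := sum_biasedWeight n α
    have hmean0 : ∀ b : Bool, 0 ≤ ∑ y, w y * g (Fin.cons b y) := fun b =>
      Finset.sum_nonneg fun y _ => mul_nonneg (hwpos y) (h0 _)
    have hmean1 : ∀ b : Bool, ∑ y, w y * g (Fin.cons b y) ≤ 1 := fun b => by
      rw [← hw1]
      exact Finset.sum_le_sum fun y _ => mul_le_of_le_one_right (hwpos y) (h1 _)
    have hgrad : ∀ (b : Bool) (y : Fin n → Bool), upGrad g (Fin.cons b y) ^ 2 =
        max (g (Fin.cons b y) - g (Fin.cons (!b) y)) 0 ^ 2 +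
          upGrad (fun z => g (Fin.cons b z)) y ^ 2 := fun b y => by
      rw [sq_upGrad, sq_upGrad, Fin.sum_univ_succ, flipc_cons_zero]
      simp only [flipc_cons_succ]
    have key : ∀ b : Bool, √(logProfile (∑ y, w y * g (Fin.cons b y)) ^ 2 + K ^ 2 *
        max (∑ y, w y * g (Fin.cons b y) - ∑ y, w y * g (Fin.cons (!b) y)) 0 ^ 2) ≤
        ∑ y, w y * √(logProfile (g (Fin.cons b y)) ^ 2 +
          K ^ 2 * upGrad g (Fin.cons b y) ^ 2) := fun b => by
      have e := ih (fun y => g (Fin.cons b y)) (fun _ => h0 _) fun _ => h1 _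
      have hm : max (∑ y, w y * g (Fin.cons b y) - ∑ y, w y * g (Fin.cons (!b) y)) 0 ≤
          ∑ y, w y * max (g (Fin.cons b y) - g (Fin.cons (!b) y)) 0 := by
        refine max_le ?_ (Finset.sum_nonneg fun y _ => mul_nonneg (hwpos y) (le_max_right _ _))
        rw [← Finset.sum_sub_distrib]
        refine Finset.sum_le_sum fun y _ => ?_
        rw [← mul_sub]
        exact mul_le_mul_of_nonneg_left (le_max_left _ _) (hwpos y)
      have hm' : K ^ 2 * max (∑ y, w y * g (Fin.cons b y) -
          ∑ y, w y * g (Fin.cons (!b) y)) 0 ^ 2 ≤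
          (∑ y, w y * (K * max (g (Fin.cons b y) - g (Fin.cons (!b) y)) 0)) ^ 2 := by
        have : ∑ y, w y * (K * max (g (Fin.cons b y) - g (Fin.cons (!b) y)) 0) =
            K * ∑ y, w y * max (g (Fin.cons b y) - g (Fin.cons (!b) y)) 0 := by
          rw [Finset.mul_sum]
          exact Finset.sum_congr rfl fun y _ => by ring
        rw [this, mul_pow]
        gcongr
      calc _ ≤ √((∑ y, w y * √(logProfile (g (Fin.cons b y)) ^ 2 +
            K ^ 2 * upGrad (fun z => g (Fin.cons b z)) y ^ 2)) ^ 2 +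
            (∑ y, w y * (K * max (g (Fin.cons b y) - g (Fin.cons (!b) y)) 0)) ^ 2) := by
            have := logProfile_nonneg (hmean0 b)
            gcongr
        _ ≤ _ := by
          refine (sqrt_sq_add_sq_sum_le _ _ _ hwpos).trans (le_of_eq ?_)
          refine Finset.sum_congr rfl fun y _ => ?_
          rw [Real.sq_sqrt (by positivity), hgrad]
          congr 2
          ring
    rw [sum_cube_succ, sum_cube_succ]
    simp only [biasedWeight_cons, mul_assoc, ← Finset.mul_sum, if_true, Bool.false_eq_true,
      if_false, ← hw]
    have kt := key true
    have kf := key false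
    simp only [Bool.not_true, Bool.not_false] at kt kf
    refine le_trans ?_ (add_le_add (mul_le_mul_of_nonneg_left kt hα0.le)
      (mul_le_mul_of_nonneg_left kf (sub_nonneg.2 hα1.le)))
    rcases le_total (∑ y, w y * g (Fin.cons false y)) (∑ y, w y * g (Fin.cons true y)) with h | h
    · rw [max_eq_left (sub_nonneg.2 h), max_eq_right (sub_nonpos.2 h)]
      refine (logProfile_two_point hα0 hα1 (hmean0 _) h (hmean1 _) hK).trans (le_of_eq ?_)
      congr 2
      norm_num
      rw [Real.sqrt_sq (logProfile_nonneg (hmean0 _))]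
    · rw [max_eq_left (sub_nonneg.2 h), max_eq_right (sub_nonpos.2 h)]
      have e := logProfile_two_point (α := 1 - α) (K := K) (by linarith) (by linarith)
        (hmean0 _) h (hmean1 _) (by rwa [sub_sub_cancel])
      rw [sub_sub_cancel] at e
      rw [add_comm (α * _), add_comm (α * _)]
      refine e.trans (le_of_eq ?_)
      congr 2
      norm_num
      rw [Real.sqrt_sq (logProfile_nonneg (hmean0 _))]

/-- The part of `r` lying between the levels `t` and `2 * t`. -/
def levelTrunc (t r : ℝ) : ℝ := min (max (r - t) 0) t

lemma levelTrunc_nonneg {t : ℝ} (ht : 0 ≤ t) (r : ℝ) : 0 ≤ levelTrunc t r :=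
  le_min (le_max_right _ _) ht

lemma levelTrunc_le (t r : ℝ) : levelTrunc t r ≤ t := min_le_right _ _

lemma levelTrunc_eq_zero {t r : ℝ} (ht : 0 ≤ t) (h : r ≤ t) : levelTrunc t r = 0 := by
  rw [levelTrunc, max_eq_right (by linarith), min_eq_left ht]

lemma levelTrunc_eq_self {t r : ℝ} (ht : 0 ≤ t) (h : 2 * t ≤ r) : levelTrunc t r = t := by
  rw [levelTrunc, max_eq_left (by linarith), min_eq_right (by linarith)]

lemma levelTrunc_sub_le {t a b : ℝ} (ht : 0 < t) :
    max (levelTrunc t a - levelTrunc t b) 0 ≤ (if t < a then 4 * t / a else 0) * max (a - b) 0 := by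
  have hm := le_max_right (a - b) 0
  split_ifs with h
  · have ha : 0 < a := ht.trans h
    refine max_le ?_ (by positivity)
    rw [div_mul_eq_mul_div, le_div_iff₀ ha]
    have h1 := le_max_left (a - b) 0
    rcases le_or_gt a (4 * t) with h4 | h4
    · have : levelTrunc t a - levelTrunc t b ≤ max (a - b) 0 := by
        unfold levelTrunc
        rcases le_total (a - b) 0 with h0 | h0
        · rw [max_eq_right h0]
          have : min (max (a - t) 0) t ≤ min (max (b - t) 0) t := by gcongr; linarith
          linarith
        · rw [max_eq_left h0]
          grind
      nlinarith
    · have hle := levelTrunc_le t a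
      have hnn := levelTrunc_nonneg ht.le b
      rcases le_or_gt (2 * t) b with h2 | h2
      · rw [levelTrunc_eq_self ht.le h2]
        nlinarith [mul_nonneg ht.le hm]
      · have : a / 2 ≤ max (a - b) 0 := by linarith
        nlinarith [mul_le_mul_of_nonneg_left this ht.le]
  · rw [levelTrunc_eq_zero ht.le (not_lt.1 h), zero_mul]
    exact max_le (by linarith [levelTrunc_nonneg ht.le b]) le_rfl

lemma sum_dyadic_lt {s : ℝ} (hs : 0 < s) {r : ℝ} (hr : 0 ≤ r) (N : ℕ) :
    ∑ k ∈ Finset.range N, (if s * 2 ^ k < r then s * 2 ^ k else 0) ≤ min (s * 2 ^ N) (2 * r) := by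
  induction N with
  | zero => simp; constructor <;> linarith
  | succ N ih =>
    rw [Finset.sum_range_succ]
    have h1 := ih.trans (min_le_left _ _)
    have h2 := ih.trans (min_le_right _ _)
    have hp : 0 < s * 2 ^ N := by positivity
    have h3 : s * 2 ^ (N + 1) = 2 * (s * 2 ^ N) := by ring
    rw [h3]
    split_ifs with h <;> refine le_min ?_ ?_ <;> linarith

lemma upGrad_le_mul {n : ℕ} {g u : (Fin n → Bool) → ℝ} {c : ℝ} (hc : 0 ≤ c) {x : Fin n → Bool}
    (h : ∀ i, max (g x - g (flipc x i)) 0 ≤ c * max (u x - u (flipc x i)) 0) :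
    upGrad g x ≤ c * upGrad u x := by
  rw [upGrad, upGrad, ← Real.sqrt_sq hc, ← Real.sqrt_mul (sq_nonneg c), Finset.mul_sum]
  refine Real.sqrt_le_sqrt (Finset.sum_le_sum fun i _ => ?_)
  rw [← mul_pow]
  exact pow_le_pow_left₀ (le_max_right _ _) (h i) 2

lemma logProfile_le {t : ℝ} (h0 : 0 ≤ t) : logProfile t ≤ 3 * t + 1 / 8 := by
  rcases h0.eq_or_lt with h | h
  · rw [← h]; simp [logProfile]
  have h1 : logProfile t ≤ √(t ^ 2 + t) := by
    rw [logProfile, show t ^ 2 + t = t ^ 2 * (1 + 1 / t) by field_simp,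
      Real.sqrt_mul (sq_nonneg t), Real.sqrt_sq h0]
    refine mul_le_mul_of_nonneg_left (Real.sqrt_le_sqrt ?_) h0
    have := Real.log_le_sub_one_of_pos (inv_pos.2 h)
    rw [Real.log_inv] at this
    rw [one_div]
    linarith
  refine h1.trans ((Real.sqrt_le_left (by positivity)).2 ?_)
  nlinarith [sq_nonneg (t - 1 / 8)]

lemma levelTrunc_mean_le {α K : ℝ} (hα0 : 0 < α) (hα1 : α < 1) (hK0 : 0 ≤ K)
    (hK : (1 - α) / α ≤ K ^ 2) (hK' : α / (1 - α) ≤ K ^ 2) {n : ℕ}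
    {u : (Fin n → Bool) → ℝ} (hu : ∀ x, 0 ≤ u x)
    (hsupp : ∑ x, biasedWeight (fun _ => α) x * (if 0 < u x then 1 else 0) ≤ Real.exp (-35))
    (hmean : ∑ x, biasedWeight (fun _ => α) x * u x ≤ 1) {t : ℝ} (ht : 0 < t) :
    (∑ x, biasedWeight (fun _ => α) x * levelTrunc t (u x)) *
        √(1 + Real.log (max (Real.exp 35) t)) ≤
      2 * K * ∑ x, biasedWeight (fun _ => α) x * upGrad (fun y => levelTrunc t (u y)) x +
        (1 / 4) * (t * ∑ x, biasedWeight (fun _ => α) x * (if t < u x then 1 else 0)) := by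
  set w : (Fin n → Bool) → ℝ := biasedWeight fun _ => α with hw
  have hwp : ∀ y, 0 ≤ w y := fun y => (biasedWeight_pos hα0 hα1 y).le
  set e := ∑ x, w x * levelTrunc t (u x) with he
  set a := ∑ x, w x * (if t < u x then (1 : ℝ) else 0) with ha
  set m := ∑ x, w x * upGrad (fun y => levelTrunc t (u y)) x with hm
  set τ := √(1 + Real.log (max (Real.exp 35) t)) with hτ
  have hm0 : 0 ≤ m := Finset.sum_nonneg fun x _ => mul_nonneg (hwp x) (upGrad_nonneg _ _)
  have ha0 : 0 ≤ a := Finset.sum_nonneg fun x _ => mul_nonneg (hwp x) (by split_ifs <;> norm_num)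
  have he0 : 0 ≤ e := Finset.sum_nonneg fun x _ => mul_nonneg (hwp x) (levelTrunc_nonneg ht.le _)
  rcases he0.eq_or_lt with h0 | hepos
  · rw [← h0, zero_mul]; positivity
  have hea : e / t ≤ a := by
    rw [div_le_iff₀ ht, he, ha, Finset.sum_mul]
    refine Finset.sum_le_sum fun x _ => ?_
    rw [mul_assoc]
    refine mul_le_mul_of_nonneg_left ?_ (hwp x)
    split_ifs with h
    · simpa using levelTrunc_le t (u x)
    · simpa using (levelTrunc_eq_zero ht.le (not_lt.1 h)).le
  have ha1 : a ≤ Real.exp (-35) := by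
    refine le_trans (Finset.sum_le_sum fun x _ => mul_le_mul_of_nonneg_left ?_ (hwp x)) hsupp
    split_ifs <;> linarith
  have ha2 : a * t ≤ 1 := by
    refine le_trans ?_ hmean
    rw [ha, Finset.sum_mul]
    refine Finset.sum_le_sum fun x _ => ?_
    rw [mul_assoc]
    refine mul_le_mul_of_nonneg_left ?_ (hwp x)
    split_ifs with h
    · linarith
    · simpa using hu x
  have hmax : e / t * max (Real.exp 35) t ≤ 1 := by
    have hnn : 0 ≤ e / t := by positivity
    rcases max_cases (Real.exp 35) t with ⟨h, _⟩ | ⟨h, _⟩ <;> rw [h]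
    · calc _ ≤ Real.exp (-35) * Real.exp 35 := by gcongr; exact hea.trans ha1
        _ = 1 := by rw [← Real.exp_add]; norm_num
    · exact (mul_le_mul_of_nonneg_right hea ht.le).trans ha2
  have hmaxpos : 0 < max (Real.exp 35) t := lt_max_of_lt_right ht
  have hlog : τ ≤ √(1 - Real.log (e / t)) := by
    refine Real.sqrt_le_sqrt ?_
    have := Real.log_nonpos (by positivity) hmax
    rw [Real.log_mul (by positivity) hmaxpos.ne'] at this
    linarith
  have hτ6 : 6 ≤ τ := by
    rw [hτ]
    apply Real.le_sqrt_of_sq_le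
    have := Real.log_le_log (Real.exp_pos 35) (le_max_left (Real.exp 35) t)
    rw [Real.log_exp] at this
    linarith
  have hJ := logProfile_sum_le_sum_sqrt hα0 hα1 hK hK' n (fun x => levelTrunc t (u x) / t)
    (fun x => div_nonneg (levelTrunc_nonneg ht.le _) ht.le)
    (fun x => (div_le_one ht).2 (levelTrunc_le _ _))
  have hmean' : ∑ x, w x * (levelTrunc t (u x) / t) = e / t := by
    rw [he, Finset.sum_div]
    exact Finset.sum_congr rfl fun x _ => by ring
  rw [← hw, hmean'] at hJ
  have hup : ∑ x, w x * √(logProfile (levelTrunc t (u x) / t) ^ 2 +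
      K ^ 2 * upGrad (fun x => levelTrunc t (u x) / t) x ^ 2) ≤ 3 * (e / t) + a / 8 + K * m / t := by
    have : 3 * (e / t) + a / 8 + K * m / t = ∑ x, w x * (3 * (levelTrunc t (u x) / t) +
        (if t < u x then 1 else 0) / 8 + K / t * upGrad (fun y => levelTrunc t (u y)) x) := by
      rw [he, ha, hm, Finset.sum_div, Finset.sum_div, Finset.mul_sum, Finset.mul_sum,
        Finset.sum_div, ← Finset.sum_add_distrib, ← Finset.sum_add_distrib]
      exact Finset.sum_congr rfl fun x _ => by ring
    rw [this]
    refine Finset.sum_le_sum fun x _ => mul_le_mul_of_nonneg_left ?_ (hwp x)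
    have hg0 : 0 ≤ levelTrunc t (u x) / t := div_nonneg (levelTrunc_nonneg ht.le _) ht.le
    have hl0 := logProfile_nonneg hg0
    have hg := upGrad_nonneg (fun x => levelTrunc t (u x) / t) x
    have h1 : √(logProfile (levelTrunc t (u x) / t) ^ 2 +
        K ^ 2 * upGrad (fun x => levelTrunc t (u x) / t) x ^ 2) ≤
        logProfile (levelTrunc t (u x) / t) + K * upGrad (fun x => levelTrunc t (u x) / t) x := by
      refine (Real.sqrt_le_left (by positivity)).2 ?_
      nlinarith [mul_nonneg hl0 (mul_nonneg hK0 hg)]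
    have h2 : upGrad (fun x => levelTrunc t (u x) / t) x ≤
        1 / t * upGrad (fun y => levelTrunc t (u y)) x := by
      refine upGrad_le_mul (by positivity) fun i => ?_
      rw [mul_max_of_nonneg _ _ (by positivity : 0 ≤ 1 / t), mul_zero]
      refine max_le_max (le_of_eq ?_) le_rfl
      ring
    have h3 : logProfile (levelTrunc t (u x) / t) ≤
        3 * (levelTrunc t (u x) / t) + (if t < u x then 1 else 0) / 8 := by
      split_ifs with h
      · exact logProfile_le hg0
      · rw [levelTrunc_eq_zero ht.le (not_lt.1 h)]; simp [logProfile]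
    have h4 := mul_le_mul_of_nonneg_left h2 hK0
    have h5 : K * (1 / t * upGrad (fun y => levelTrunc t (u y)) x) =
      K / t * upGrad (fun y => levelTrunc t (u y)) x := by ring
    linarith
  have h := hJ.trans hup
  have h6 : e / t * τ ≤ logProfile (e / t) :=
    mul_le_mul_of_nonneg_left hlog (by positivity)
  have h7 := h6.trans h
  have h8 := mul_le_mul_of_nonneg_left h7 ht.le
  have e1 : t * (e / t * τ) = e * τ := by field_simp
  have e2 : t * (3 * (e / t) + a / 8 + K * m / t) = 3 * e + t * a / 8 + K * m := by field_simp
  rw [e1, e2] at h8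
  nlinarith

lemma mul_sqrt_log_le_levelTrunc {t r : ℝ} (ht : 0 < t) (h1 : 2 * t ≤ r) (h2 : r < 4 * t) :
    r * √(Real.log (Real.exp 1 + r)) ≤
      6 * (levelTrunc t r * √(1 + Real.log (max (Real.exp 35) t))) := by
  rw [levelTrunc_eq_self ht.le h1]
  set m := max (Real.exp 35) t with hm
  have hm1 : t ≤ m := le_max_right _ _
  have hm2 : Real.exp 35 ≤ m := le_max_left _ _
  have hmpos : 0 < m := ht.trans_le hm1
  have he : (2 : ℝ) ≤ Real.exp 1 := by linarith [Real.add_one_le_exp 1]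
  have hm3 : 36 ≤ m := by linarith [Real.add_one_le_exp 35]
  have he35 : Real.exp 1 ≤ m := (Real.exp_le_exp.2 (by norm_num)).trans hm2
  have hsq : √(Real.log (Real.exp 1 + r)) ≤ (3 / 2) * √(1 + Real.log m) := by
    rw [show (3 / 2 : ℝ) = √(9 / 4) by
      rw [show (9 / 4 : ℝ) = (3 / 2) ^ 2 by norm_num, Real.sqrt_sq (by norm_num)],
      ← Real.sqrt_mul (by norm_num)]
    refine Real.sqrt_le_sqrt ?_
    have : Real.log (Real.exp 1 + r) ≤ Real.log ((Real.exp 1 * m) ^ 2) := by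
      have hr : 0 < r := by linarith
      refine Real.log_le_log (by positivity) ?_
      nlinarith [mul_le_mul he le_rfl hmpos.le (by linarith)]
    rw [Real.log_pow, Real.log_mul (by positivity) hmpos.ne', Real.log_exp] at this
    push_cast at this
    have := Real.log_nonneg (show 1 ≤ m by linarith)
    linarith
  have h0 := Real.sqrt_nonneg (Real.log (Real.exp 1 + r))
  nlinarith [mul_le_mul_of_nonneg_left hsq ht.le]

lemma sum_mul_sqrt_log_le_add {α K : ℝ} (hα0 : 0 < α) (hα1 : α < 1) (hK0 : 0 ≤ K)
    (hK : (1 - α) / α ≤ K ^ 2) (hK' : α / (1 - α) ≤ K ^ 2) {n : ℕ}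
    {u : (Fin n → Bool) → ℝ} (hu : ∀ x, 0 ≤ u x)
    (hsupp : ∑ x, biasedWeight (fun _ => α) x * (if 0 < u x then 1 else 0) ≤ Real.exp (-35))
    (hmean : ∑ x, biasedWeight (fun _ => α) x * u x ≤ 1) {s : ℝ} (hs : 0 < s) (hs1 : s ≤ 1) :
    ∑ x, biasedWeight (fun _ => α) x * (u x * √(Real.log (Real.exp 1 + u x))) ≤
      192 * K * ∑ x, biasedWeight (fun _ => α) x * upGrad u x + 76 * s := by
  set w : (Fin n → Bool) → ℝ := biasedWeight fun _ => α with hw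
  have hwp : ∀ y, 0 ≤ w y := fun y => (biasedWeight_pos hα0 hα1 y).le
  have hw1 : ∑ y, w y = 1 := sum_biasedWeight n α
  set T : ℕ → ℝ := fun k => s * 2 ^ k with hT
  have hTpos : ∀ k, 0 < T k := fun k => by positivity
  set τ : ℕ → ℝ := fun k => √(1 + Real.log (max (Real.exp 35) (T k))) with hτ
  have hτ1 : ∀ k, 1 ≤ τ k := fun k => by
    refine Real.one_le_sqrt.2 ?_
    have := Real.log_nonneg ((Real.one_le_exp (by norm_num : (0 : ℝ) ≤ 35)).trans
      (le_max_left (Real.exp 35) (T k)))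
    linarith
  set e : ℕ → ℝ := fun k => ∑ x, w x * levelTrunc (T k) (u x) with he
  have he0 : ∀ k, 0 ≤ e k := fun k =>
    Finset.sum_nonneg fun x _ => mul_nonneg (hwp x) (levelTrunc_nonneg (hTpos k).le _)
  set m : ℕ → ℝ := fun k => ∑ x, w x * upGrad (fun y => levelTrunc (T k) (u y)) x with hm
  have hm0 : ∀ k, 0 ≤ m k := fun k =>
    Finset.sum_nonneg fun x _ => mul_nonneg (hwp x) (upGrad_nonneg _ _)
  have hstep : ∀ k, e (k + 1) * τ (k + 1) ≤ 2 * K * m (k + 1) + (1 / 2) * (e k * τ k) := by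
    intro k
    have h := levelTrunc_mean_le hα0 hα1 hK0 hK hK' hu hsupp hmean (hTpos (k + 1))
    have h2 : T (k + 1) * ∑ x, w x * (if T (k + 1) < u x then 1 else 0) ≤ 2 * e k := by
      rw [he, Finset.mul_sum, Finset.mul_sum]
      refine Finset.sum_le_sum fun x _ => ?_
      have hT2 : T (k + 1) = 2 * T k := by simp only [hT, pow_succ]; ring
      split_ifs with h
      · rw [levelTrunc_eq_self (hTpos k).le (by linarith), hT2]
        linarith
      · have := mul_nonneg (hwp x) (levelTrunc_nonneg (hTpos k).le (u x))
        simp only [mul_zero]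
        linarith
    have h3 := le_mul_of_one_le_right (he0 k) (hτ1 k)
    linarith
  have hzero : e 0 * τ 0 ≤ 6 * s := by
    have h1 : τ 0 = 6 := by
      have : T 0 = s := by simp [hT]
      simp only [hτ, this]
      rw [max_eq_left, Real.log_exp, show (1 + 35 : ℝ) = 6 ^ 2 by norm_num, Real.sqrt_sq]
      · norm_num
      · linarith [Real.add_one_le_exp 35]
    have h2 : e 0 ≤ s := by
      calc e 0 ≤ ∑ x, w x * s := by
            refine Finset.sum_le_sum fun x _ => mul_le_mul_of_nonneg_left ?_ (hwp x)
            refine (levelTrunc_le _ _).trans (le_of_eq ?_)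
            simp [hT]
        _ = s := by rw [← Finset.sum_mul, hw1, one_mul]
    rw [h1]
    linarith
  have hsum : ∀ N, ∑ k ∈ Finset.range N, e k * τ k ≤
      12 * s + 4 * K * ∑ k ∈ Finset.range N, m k := by
    intro N
    rcases N with _ | N
    · simp [hs.le]
    have h1 : ∑ k ∈ Finset.range (N + 1), e k * τ k ≤ 6 * s + ∑ k ∈ Finset.range N,
        (2 * K * m (k + 1) + (1 / 2) * (e k * τ k)) := by
      rw [Finset.sum_range_succ']
      linarith [Finset.sum_le_sum fun k (_ : k ∈ Finset.range N) => hstep k]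
    rw [Finset.sum_add_distrib, ← Finset.mul_sum, ← Finset.mul_sum] at h1
    have h2 : ∑ k ∈ Finset.range N, e k * τ k ≤ ∑ k ∈ Finset.range (N + 1), e k * τ k := by
      rw [Finset.sum_range_succ]
      linarith [mul_nonneg (he0 N) (zero_le_one.trans (hτ1 N))]
    have h3 : ∑ k ∈ Finset.range N, m (k + 1) ≤ ∑ k ∈ Finset.range (N + 1), m k := by
      rw [Finset.sum_range_succ']
      linarith [hm0 0]
    nlinarith [mul_le_mul_of_nonneg_left h3 hK0]
  have hmsum : ∀ N, ∑ k ∈ Finset.range N, m k ≤ 8 * ∑ x, w x * upGrad u x := by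
    intro N
    rw [hm, Finset.sum_comm, Finset.mul_sum]
    refine Finset.sum_le_sum fun x _ => ?_
    rw [← Finset.mul_sum, mul_left_comm]
    refine mul_le_mul_of_nonneg_left ?_ (hwp x)
    have h1 : ∀ k ∈ Finset.range N, upGrad (fun y => levelTrunc (T k) (u y)) x ≤
        (if T k < u x then 4 * T k / u x else 0) * upGrad u x := fun k _ => by
      refine upGrad_le_mul ?_ fun i => levelTrunc_sub_le (hTpos k)
      have := hTpos k
      have := hu x
      split_ifs <;> positivity
    refine (Finset.sum_le_sum h1).trans ?_
    rw [← Finset.sum_mul]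
    refine mul_le_mul_of_nonneg_right ?_ (upGrad_nonneg _ _)
    rcases (hu x).eq_or_lt with h0 | h0
    · rw [← h0]
      simp
    have h2 : ∀ k ∈ Finset.range N, (if T k < u x then 4 * T k / u x else 0) =
        4 / u x * (if T k < u x then T k else 0) := fun k _ => by
      split_ifs <;> ring
    rw [Finset.sum_congr rfl h2, ← Finset.mul_sum]
    have h3 := (sum_dyadic_lt hs h0.le N).trans (min_le_right _ _)
    calc _ ≤ 4 / u x * (2 * u x) := by gcongr
      _ = 8 := by field_simp; norm_num
  obtain ⟨N, hN⟩ := pow_unbounded_of_one_lt ((∑ x, u x) / s) (one_lt_two)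
  have hNx : ∀ x, u x < s * 2 ^ N := fun x => by
    rw [div_lt_iff₀ hs] at hN
    linarith [Finset.single_le_sum (fun y _ => hu y) (Finset.mem_univ x)]
  have hpt : ∀ x, u x * √(Real.log (Real.exp 1 + u x)) ≤
      6 * ∑ k ∈ Finset.range N, levelTrunc (T k) (u x) * τ k + 4 * s := by
    intro x
    have hnn : ∀ k, 0 ≤ levelTrunc (T k) (u x) * τ k := fun k =>
      mul_nonneg (levelTrunc_nonneg (hTpos k).le _) (zero_le_one.trans (hτ1 k))
    rcases le_or_gt (2 * s) (u x) with h | h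
    · obtain ⟨k, hk1, hk2⟩ := exists_nat_pow_near ((one_le_div (by positivity)).2 h) one_lt_two
      rw [le_div_iff₀ (by positivity)] at hk1
      rw [div_lt_iff₀ (by positivity), pow_succ] at hk2
      have hkN : k ∈ Finset.range N := by
        rw [Finset.mem_range]
        have : (2 : ℝ) ^ k * s < 2 ^ N * s := by
          have := hNx x
          have : (0 : ℝ) < 2 ^ k * s := by positivity
          linarith
        exact (pow_lt_pow_iff_right₀ one_lt_two).1 (lt_of_mul_lt_mul_right this hs.le)
      have h1 := mul_sqrt_log_le_levelTrunc (hTpos k) (r := u x)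
        (by simp only [hT]; linarith) (by simp only [hT]; linarith)
      have h2 := Finset.single_le_sum (fun k _ => hnn k) hkN
      linarith
    · have h1 : √(Real.log (Real.exp 1 + u x)) ≤ 2 := by
        refine (Real.sqrt_le_left (by norm_num)).2 ?_
        have h0 := hu x
        have he : (2 : ℝ) ≤ Real.exp 1 := by linarith [Real.add_one_le_exp 1]
        rw [← Real.log_exp (2 ^ 2), show ((2 : ℝ) ^ 2) = 1 + (1 + (1 + 1)) by norm_num,
          Real.exp_add, Real.exp_add, Real.exp_add]
        refine Real.log_le_log (by positivity) ?_
        nlinarith [mul_le_mul he he (by norm_num) (by linarith)]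
      have h3 : 0 ≤ ∑ k ∈ Finset.range N, levelTrunc (T k) (u x) * τ k :=
        Finset.sum_nonneg fun k _ => hnn k
      nlinarith [mul_le_mul_of_nonneg_left h1 (hu x)]
  calc _ ≤ ∑ x, w x * (6 * ∑ k ∈ Finset.range N, levelTrunc (T k) (u x) * τ k + 4 * s) :=
        Finset.sum_le_sum fun x _ => mul_le_mul_of_nonneg_left (hpt x) (hwp x)
    _ = 6 * ∑ k ∈ Finset.range N, e k * τ k + 4 * s := by
      simp only [mul_add, Finset.sum_add_distrib, ← Finset.sum_mul, hw1, one_mul, he]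
      congr 1
      simp only [Finset.sum_mul, Finset.mul_sum]
      rw [Finset.sum_comm]
      exact Finset.sum_congr rfl fun k _ => Finset.sum_congr rfl fun x _ => by ring
    _ ≤ _ := by
      have := mul_le_mul_of_nonneg_left (hmsum N) hK0
      linarith [hsum N]

/-- A one-sided `L (log L)^{1/2}` Sobolev inequality for functions with small support. -/
lemma sum_mul_sqrt_log_le {α K : ℝ} (hα0 : 0 < α) (hα1 : α < 1) (hK0 : 0 ≤ K)
    (hK : (1 - α) / α ≤ K ^ 2) (hK' : α / (1 - α) ≤ K ^ 2) {n : ℕ}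
    {u : (Fin n → Bool) → ℝ} (hu : ∀ x, 0 ≤ u x)
    (hsupp : ∑ x, biasedWeight (fun _ => α) x * (if 0 < u x then 1 else 0) ≤ Real.exp (-35))
    (hmean : ∑ x, biasedWeight (fun _ => α) x * u x ≤ 1) :
    ∑ x, biasedWeight (fun _ => α) x * (u x * √(Real.log (Real.exp 1 + u x))) ≤
      192 * K * ∑ x, biasedWeight (fun _ => α) x * upGrad u x := by
  refine le_of_forall_pos_le_add fun ε hε => ?_
  have h := sum_mul_sqrt_log_le_add hα0 hα1 hK0 hK hK' hu hsupp hmean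
    (s := min 1 (ε / 76)) (by positivity) (min_le_left _ _)
  have := min_le_right 1 (ε / 76)
  linarith

/-- The Young function `s ^ p * log (e + s ^ p) ^ (p / 2)`. -/
def youngFun (p s : ℝ) : ℝ := s ^ p * Real.log (Real.exp 1 + s ^ p) ^ (p / 2)

lemma one_le_log_exp_add {p s : ℝ} (hs : 0 ≤ s) : 1 ≤ Real.log (Real.exp 1 + s ^ p) := by
  have := Real.rpow_nonneg hs p
  rw [Real.le_log_iff_exp_le (by positivity)]
  linarith

lemma youngFun_nonneg {p s : ℝ} (hs : 0 ≤ s) : 0 ≤ youngFun p s :=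
  mul_nonneg (Real.rpow_nonneg hs p)
    (Real.rpow_nonneg (zero_le_one.trans (one_le_log_exp_add hs)) _)

lemma youngFun_zero {p : ℝ} (hp : 1 ≤ p) : youngFun p 0 = 0 := by
  rw [youngFun, Real.zero_rpow (by linarith), zero_mul]

lemma log_exp_add_rpow_mono {p r s : ℝ} (hp : 0 ≤ p) (hr : 0 ≤ r) (hrs : r ≤ s) :
    Real.log (Real.exp 1 + r ^ p) ≤ Real.log (Real.exp 1 + s ^ p) := by
  have := Real.rpow_nonneg hr p
  refine Real.log_le_log (by positivity) ?_
  gcongr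

lemma youngFun_mul_le {p c s : ℝ} (hp : 1 ≤ p) (hc0 : 0 ≤ c) (hc1 : c ≤ 1) (hs : 0 ≤ s) :
    youngFun p (c * s) ≤ c * youngFun p s := by
  have hcs : c * s ≤ s := mul_le_of_le_one_left hs hc1
  have h1 : c ^ p ≤ c := by
    simpa using Real.rpow_le_rpow_of_exponent_ge' hc0 hc1 zero_le_one hp
  have h2 := Real.rpow_le_rpow (zero_le_one.trans (one_le_log_exp_add (mul_nonneg hc0 hs)))
    (log_exp_add_rpow_mono (by linarith : 0 ≤ p) (mul_nonneg hc0 hs) hcs)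
    (by linarith : 0 ≤ p / 2)
  have h3 := Real.rpow_nonneg hs p
  have h4 := Real.rpow_nonneg (zero_le_one.trans (one_le_log_exp_add (p := p) hs)) (p / 2)
  calc youngFun p (c * s) ≤ (c * s) ^ p * Real.log (Real.exp 1 + s ^ p) ^ (p / 2) :=
        mul_le_mul_of_nonneg_left h2 (Real.rpow_nonneg (mul_nonneg hc0 hs) p)
    _ = c ^ p * (s ^ p * Real.log (Real.exp 1 + s ^ p) ^ (p / 2)) := by
        rw [Real.mul_rpow hc0 hs, mul_assoc]
    _ ≤ _ := mul_le_mul_of_nonneg_right h1 (mul_nonneg h3 h4)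

lemma youngFun_mono {p r s : ℝ} (hp : 1 ≤ p) (hr : 0 ≤ r) (hrs : r ≤ s) :
    youngFun p r ≤ youngFun p s := by
  have hs := hr.trans hrs
  have h2 := log_exp_add_rpow_mono (by linarith : 0 ≤ p) hr hrs
  have h3 := one_le_log_exp_add (p := p) hr
  have h4 := Real.rpow_nonneg hs p
  unfold youngFun
  gcongr

lemma continuousOn_youngFun {p : ℝ} (hp : 1 ≤ p) : ContinuousOn (youngFun p) (Set.Ici 0) := by
  intro s hs
  have hs : 0 ≤ s := hs
  have h1 : ContinuousAt (fun s : ℝ => s ^ p) s :=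
    Real.continuousAt_rpow_const s p (Or.inr (by linarith))
  have h0 := Real.rpow_nonneg hs p
  have h2 : ContinuousAt (fun s : ℝ => Real.log (Real.exp 1 + s ^ p)) s :=
    (continuousAt_const.add h1).log (ne_of_gt (by positivity : 0 < Real.exp 1 + s ^ p))
  exact (h1.mul (h2.rpow_const (Or.inr (by linarith)))).continuousWithinAt

/-- A function with `youngPow p s * √(log (e + s ^ p)) = youngFun p s`. -/
def youngPow (p s : ℝ) : ℝ := s ^ p * Real.log (Real.exp 1 + s ^ p) ^ ((p - 1) / 2)

/-- The quotient `youngPow p s / s`. -/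
def youngSlope (p s : ℝ) : ℝ := s ^ (p - 1) * Real.log (Real.exp 1 + s ^ p) ^ ((p - 1) / 2)

lemma youngSlope_nonneg {p s : ℝ} (hs : 0 ≤ s) : 0 ≤ youngSlope p s :=
  mul_nonneg (Real.rpow_nonneg hs _)
    (Real.rpow_nonneg (zero_le_one.trans (one_le_log_exp_add hs)) _)

lemma rpow_mul_log_le {p θ s : ℝ} (h0 : 0 ≤ θ) (h1 : θ ≤ 1) (hp : 0 ≤ p) (hs : 0 ≤ s) :
    θ ^ p * Real.log (Real.exp 1 + s ^ p) ≤ Real.log (Real.exp 1 + (θ * s) ^ p) := by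
  have ht0 := Real.rpow_nonneg h0 p
  have ht1 := Real.rpow_le_one h0 h1 hp
  have hsp := Real.rpow_nonneg hs p
  have he : (1 : ℝ) ≤ Real.exp 1 := Real.one_le_exp zero_le_one
  rw [Real.mul_rpow h0 hs, ← Real.log_rpow (by positivity)]
  refine Real.log_le_log (by positivity) ?_
  have h := Real.geom_mean_le_arith_mean2_weighted ht0 (sub_nonneg.2 ht1)
    (by positivity : 0 ≤ Real.exp 1 + s ^ p) zero_le_one (by ring)
  rw [Real.one_rpow, mul_one] at h
  nlinarith

lemma youngPow_sub_le {p r s : ℝ} (hp : 1 ≤ p) (hr : 0 ≤ r) (hs : 0 ≤ s) :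
    max (youngPow p s - youngPow p r) 0 ≤
      (p + p * (p - 1) / 2) * youngSlope p s * max (s - r) 0 := by
  have hm : 1 ≤ p + p * (p - 1) / 2 := by nlinarith
  have hH := youngSlope_nonneg (p := p) hs
  rcases le_or_gt s r with h | h
  · have : youngPow p s ≤ youngPow p r := by
      have h2 := log_exp_add_rpow_mono (by linarith : 0 ≤ p) hs h
      have h3 := one_le_log_exp_add (p := p) hs
      have h4 := Real.rpow_nonneg hr p
      unfold youngPow
      gcongr
    rw [max_eq_right (by linarith)]
    positivity
  have hs0 : 0 < s := hr.trans_lt h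
  rw [max_eq_left (sub_nonneg.2 h.le)]
  refine max_le ?_ (by have := sub_nonneg.2 h.le; positivity)
  obtain ⟨θ, rfl⟩ : ∃ θ, r = θ * s := ⟨r / s, by field_simp⟩
  have hθ0 : 0 ≤ θ := nonneg_of_mul_nonneg_left hr hs0
  have hθ1 : θ ≤ 1 := by
    by_contra! hc
    nlinarith
  have hL := one_le_log_exp_add (p := p) hs
  have h1 := Real.rpow_le_rpow (by positivity) (rpow_mul_log_le hθ0 hθ1 (by linarith : 0 ≤ p) hs)
    (by linarith : 0 ≤ (p - 1) / 2)
  have hθm : θ ^ (p + p * (p - 1) / 2) = θ ^ p * (θ ^ p) ^ ((p - 1) / 2) := by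
    rw [← Real.rpow_mul hθ0, ← Real.rpow_add_of_nonneg hθ0 (by linarith)
      (mul_nonneg (by linarith) (by linarith))]
    ring_nf
  have h2 : θ ^ (p + p * (p - 1) / 2) * youngPow p s ≤ youngPow p (θ * s) := by
    rw [hθm]
    unfold youngPow
    rw [Real.mul_rpow (by positivity) (by positivity)] at h1
    have := mul_le_mul_of_nonneg_left h1 (by positivity : 0 ≤ (θ * s) ^ p)
    refine le_trans (le_of_eq ?_) this
    rw [Real.mul_rpow hθ0 hs]
    ring
  have h3 : youngPow p s = s * youngSlope p s := by
    rw [youngPow, youngSlope, ← mul_assoc]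
    congr 1
    rw [← Real.rpow_one_add' hs (by linarith)]
    ring_nf
  have h4 := one_add_mul_self_le_rpow_one_add (by linarith : -1 ≤ θ - 1) hm
  rw [add_sub_cancel] at h4
  have hG : 0 ≤ youngPow p s := by rw [h3]; positivity
  have h5 := mul_le_mul_of_nonneg_right h4 hG
  rw [h3] at h2 h5 ⊢
  nlinarith

lemma youngSlope_mul_le {p s Y : ℝ} (hp : 1 ≤ p) (hs : 0 ≤ s) (hY : 0 ≤ Y) :
    youngSlope p s * Y ≤ (1 - 1 / p) * youngFun p s + 1 / p * Y ^ p := by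
  have hp0 : 0 < p := by linarith
  have hp1 : 1 / p ≤ 1 := (div_le_one hp0).2 hp
  have hL := one_le_log_exp_add (p := p) hs
  have h := Real.geom_mean_le_arith_mean2_weighted (sub_nonneg.2 hp1) (by positivity : 0 ≤ 1 / p)
    (youngFun_nonneg (p := p) hs) (Real.rpow_nonneg hY p) (by ring)
  refine le_trans (le_of_eq ?_) h
  rw [← Real.rpow_mul hY, mul_one_div_cancel hp0.ne', Real.rpow_one, youngFun, youngSlope,
    Real.mul_rpow (by positivity) (by positivity), ← Real.rpow_mul hs,
    ← Real.rpow_mul (by positivity)]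
  have e1 : p * (1 - 1 / p) = p - 1 := by field_simp
  have e2 : p / 2 * (1 - 1 / p) = (p - 1) / 2 := by field_simp
  rw [e1, e2]

lemma one_le_of_sum_youngFun_eq_one {α K : ℝ} (hα0 : 0 < α) (hα1 : α < 1) (hK0 : 0 ≤ K)
    (hK : (1 - α) / α ≤ K ^ 2) (hK' : α / (1 - α) ≤ K ^ 2) {p : ℝ} (hp : 1 ≤ p) {n : ℕ}
    {v : (Fin n → Bool) → ℝ} (hv : ∀ x, 0 ≤ v x)
    (hsupp : ∑ x, biasedWeight (fun _ => α) x * (if 0 < v x then 1 else 0) ≤ Real.exp (-35))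
    (h1 : ∑ x, biasedWeight (fun _ => α) x * youngFun p (v x) = 1) :
    1 ≤ ∑ x, biasedWeight (fun _ => α) x *
      (192 * K * (p + p * (p - 1) / 2) * upGrad v x) ^ p := by
  set w : (Fin n → Bool) → ℝ := biasedWeight fun _ => α with hw
  have hwp : ∀ y, 0 ≤ w y := fun y => (biasedWeight_pos hα0 hα1 y).le
  have hp0 : 0 < p := by linarith
  have hm : 0 ≤ p + p * (p - 1) / 2 := by nlinarith
  set g : (Fin n → Bool) → ℝ := fun x => youngPow p (v x) with hg
  have hL : ∀ x, 1 ≤ Real.log (Real.exp 1 + v x ^ p) := fun x => one_le_log_exp_add (hv x)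
  have hvp : ∀ x, 0 ≤ v x ^ p := fun x => Real.rpow_nonneg (hv x) p
  have hg0 : ∀ x, 0 ≤ g x := fun x =>
    mul_nonneg (hvp x) (Real.rpow_nonneg (zero_le_one.trans (hL x)) _)
  have hgv : ∀ x, v x ^ p ≤ g x := fun x =>
    le_mul_of_one_le_right (hvp x) (Real.one_le_rpow (hL x) (by linarith))
  have hgmean : ∑ x, w x * g x ≤ 1 := by
    rw [← h1]
    refine Finset.sum_le_sum fun x _ => mul_le_mul_of_nonneg_left ?_ (hwp x)
    exact mul_le_mul_of_nonneg_left
      (Real.rpow_le_rpow_of_exponent_le (hL x) (by linarith)) (hvp x)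
  have hgsupp : ∑ x, w x * (if 0 < g x then 1 else 0) ≤ Real.exp (-35) := by
    refine le_trans (Finset.sum_le_sum fun x _ => mul_le_mul_of_nonneg_left ?_ (hwp x)) hsupp
    split_ifs with ha hb <;> try norm_num
    have : v x = 0 := le_antisymm (not_lt.1 hb) (hv x)
    simp [hg, youngPow, this, Real.zero_rpow hp0.ne'] at ha
  have hmain := sum_mul_sqrt_log_le hα0 hα1 hK0 hK hK' hg0 hgsupp hgmean
  have hlow : 1 ≤ ∑ x, w x * (g x * √(Real.log (Real.exp 1 + g x))) := by
    refine h1.ge.trans (Finset.sum_le_sum fun x _ => mul_le_mul_of_nonneg_left ?_ (hwp x))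
    have e : youngFun p (v x) = g x * √(Real.log (Real.exp 1 + v x ^ p)) := by
      simp only [hg]
      rw [youngFun, youngPow, Real.sqrt_eq_rpow, mul_assoc,
        ← Real.rpow_add (zero_lt_one.trans_le (hL x))]
      ring_nf
    rw [e]
    refine mul_le_mul_of_nonneg_left (Real.sqrt_le_sqrt ?_) (hg0 x)
    refine Real.log_le_log (by have := hvp x; positivity) ?_
    linarith [hgv x]
  have hup : 192 * K * ∑ x, w x * upGrad g x ≤ ∑ x, w x * ((1 - 1 / p) * youngFun p (v x) +
      1 / p * (192 * K * (p + p * (p - 1) / 2) * upGrad v x) ^ p) := by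
    rw [Finset.mul_sum]
    refine Finset.sum_le_sum fun x _ => ?_
    rw [mul_left_comm]
    refine mul_le_mul_of_nonneg_left ?_ (hwp x)
    have hU := upGrad_nonneg v x
    have a1 : upGrad g x ≤ (p + p * (p - 1) / 2) * youngSlope p (v x) * upGrad v x :=
      upGrad_le_mul (mul_nonneg hm (youngSlope_nonneg (hv x))) fun i =>
        youngPow_sub_le hp (hv _) (hv x)
    have a2 := youngSlope_mul_le hp (hv x)
      (by positivity : 0 ≤ 192 * K * (p + p * (p - 1) / 2) * upGrad v x)
    have a3 := mul_le_mul_of_nonneg_left a1 (by positivity : 0 ≤ 192 * K)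
    linarith
  have hfin := hlow.trans (hmain.trans hup)
  have e3 : ∑ x, w x * ((1 - 1 / p) * youngFun p (v x) +
      1 / p * (192 * K * (p + p * (p - 1) / 2) * upGrad v x) ^ p) =
      (1 - 1 / p) * ∑ x, w x * youngFun p (v x) +
      1 / p * ∑ x, w x * (192 * K * (p + p * (p - 1) / 2) * upGrad v x) ^ p := by
    rw [Finset.mul_sum, Finset.mul_sum, ← Finset.sum_add_distrib]
    exact Finset.sum_congr rfl fun x _ => by ring
  rw [e3, h1] at hfin
  have h8 : 1 / p * 1 ≤
      1 / p * ∑ x, w x * (192 * K * (p + p * (p - 1) / 2) * upGrad v x) ^ p := by linarith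
  exact le_of_mul_le_mul_left h8 (by positivity)

/-- A one-sided `L_p (log L)^{p/2}` Sobolev inequality for functions with small support. -/
lemma sum_youngFun_div_le_one {α K : ℝ} (hα0 : 0 < α) (hα1 : α < 1) (hK0 : 0 ≤ K)
    (hK : (1 - α) / α ≤ K ^ 2) (hK' : α / (1 - α) ≤ K ^ 2) {p : ℝ} (hp : 1 ≤ p) {n : ℕ}
    {u : (Fin n → Bool) → ℝ} (hu : ∀ x, 0 ≤ u x)
    (hsupp : ∑ x, biasedWeight (fun _ => α) x * (if 0 < u x then 1 else 0) ≤ Real.exp (-35))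
    {γ : ℝ} (hγ0 : 0 < γ)
    (hγ : 192 * K * (p + p * (p - 1) / 2) *
      (∑ x, biasedWeight (fun _ => α) x * upGrad u x ^ p) ^ (1 / p) < γ) :
    ∑ x, biasedWeight (fun _ => α) x * youngFun p (u x / γ) ≤ 1 := by
  by_contra! hcon
  set w : (Fin n → Bool) → ℝ := biasedWeight fun _ => α with hw
  have hwp : ∀ y, 0 ≤ w y := fun y => (biasedWeight_pos hα0 hα1 y).le
  have hp0 : 0 < p := by linarith
  have hm : 0 ≤ p + p * (p - 1) / 2 := by nlinarith
  set Z : ℝ → ℝ := fun c => ∑ x, w x * youngFun p (c * (u x / γ)) with hZ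
  have hq : ∀ x, 0 ≤ u x / γ := fun x => div_nonneg (hu x) hγ0.le
  have hZc : ContinuousOn Z (Set.Icc 0 1) := by
    refine continuousOn_finsetSum _ fun x _ => continuousOn_const.mul ?_
    exact (continuousOn_youngFun hp).comp (by fun_prop) fun c hc => mul_nonneg hc.1 (hq x)
  have hZ0 : Z 0 = 0 := by simp [hZ, youngFun_zero hp]
  have hZ1 : 1 < Z 1 := by simpa [hZ] using hcon
  obtain ⟨c, ⟨hc0, hc1⟩, hc⟩ := intermediate_value_Icc zero_le_one hZc
    (show (1 : ℝ) ∈ Set.Icc (Z 0) (Z 1) from ⟨by rw [hZ0]; exact zero_le_one, hZ1.le⟩)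
  have hcpos : 0 < c := by
    rcases hc0.eq_or_lt with h | h
    · rw [← h, hZ0] at hc; norm_num at hc
    · exact h
  have hone := one_le_of_sum_youngFun_eq_one hα0 hα1 hK0 hK hK' hp
    (v := fun x => c * (u x / γ)) (fun x => mul_nonneg hc0 (hq x)) (by
      refine le_trans (Finset.sum_le_sum fun x _ => mul_le_mul_of_nonneg_left ?_ (hwp x)) hsupp
      split_ifs with ha hb <;> try norm_num
      have : u x = 0 := le_antisymm (not_lt.1 hb) (hu x)
      simp [this] at ha) hc
  set A := 192 * K * (p + p * (p - 1) / 2) with hA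
  have hA0 : 0 ≤ A := by positivity
  set S := ∑ x, w x * upGrad u x ^ p with hS
  have hS0 : 0 ≤ S := Finset.sum_nonneg fun x _ =>
    mul_nonneg (hwp x) (Real.rpow_nonneg (upGrad_nonneg _ _) _)
  have hle : ∑ x, w x * (A * upGrad (fun x => c * (u x / γ)) x) ^ p ≤ (A / γ) ^ p * S := by
    rw [hS, Finset.mul_sum]
    refine Finset.sum_le_sum fun x _ => ?_
    rw [mul_left_comm, ← Real.mul_rpow (by positivity) (upGrad_nonneg _ _)]
    refine mul_le_mul_of_nonneg_left (Real.rpow_le_rpow ?_ ?_ hp0.le) (hwp x)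
    · exact mul_nonneg hA0 (upGrad_nonneg _ _)
    · rw [div_mul_eq_mul_div, mul_div_assoc]
      refine mul_le_mul_of_nonneg_left ?_ hA0
      rw [div_eq_inv_mul]
      refine upGrad_le_mul (by positivity) fun i => ?_
      rw [show c * (u x / γ) - c * (u (flipc x i) / γ) = c * (γ⁻¹ * (u x - u (flipc x i))) by ring]
      refine max_le ?_ (mul_nonneg (by positivity) (le_max_right _ _))
      have h1 : γ⁻¹ * (u x - u (flipc x i)) ≤ γ⁻¹ * max (u x - u (flipc x i)) 0 :=
        mul_le_mul_of_nonneg_left (le_max_left _ _) (by positivity)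
      have h2 : 0 ≤ γ⁻¹ * max (u x - u (flipc x i)) 0 :=
        mul_nonneg (by positivity) (le_max_right _ _)
      nlinarith
  have hS' : S = (S ^ (1 / p)) ^ p := by
    rw [← Real.rpow_mul hS0, one_div_mul_cancel hp0.ne', Real.rpow_one]
  rw [hS', ← Real.mul_rpow (by positivity) (by positivity)] at hle
  have hlt : A / γ * S ^ (1 / p) < 1 := by
    rw [div_mul_eq_mul_div, div_lt_one hγ0]
    exact hγ
  have := Real.rpow_lt_one (by positivity) hlt hp0
  linarith

/-- The mean norm of a Rademacher sum. -/
def radMean {X : Type*} [NormedAddCommGroup X] [NormedSpace ℝ X] {n : ℕ} (v : Fin n → X) : ℝ :=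
  (2 ^ n : ℝ)⁻¹ * ∑ δ : Fin n → Bool, ‖∑ i, sgn (δ i) • v i‖

lemma sum_sq_rademacher {n : ℕ} (c : Fin n → ℝ) :
    ∑ δ : Fin n → Bool, (∑ i, sgn (δ i) * c i) ^ 2 = 2 ^ n * ∑ i, c i ^ 2 := by
  induction n with
  | zero => simp
  | succ n ih =>
    rw [sum_cube_succ, ← Finset.sum_add_distrib]
    simp only [Fin.sum_univ_succ, Fin.cons_zero, Fin.cons_succ]
    calc _ = ∑ δ : Fin n → Bool,
          (2 * c 0 ^ 2 + 2 * (∑ i : Fin n, sgn (δ i) * c i.succ) ^ 2) :=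
          Finset.sum_congr rfl fun δ _ => by
            simp only [sgn, if_true, Bool.false_eq_true, if_false]
            ring
      _ = _ := by
          rw [Finset.sum_add_distrib, Finset.sum_const, ← Finset.mul_sum _ _ (2 : ℝ), ih]
          simp
          ring

lemma sum_pow_four_rademacher_le {n : ℕ} (c : Fin n → ℝ) :
    ∑ δ : Fin n → Bool, (∑ i, sgn (δ i) * c i) ^ 4 ≤ 2 ^ n * (3 * (∑ i, c i ^ 2) ^ 2) := by
  induction n with
  | zero => simp
  | succ n ih =>
    rw [sum_cube_succ, ← Finset.sum_add_distrib]
    simp only [Fin.sum_univ_succ, Fin.cons_zero, Fin.cons_succ]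
    calc _ = ∑ δ : Fin n → Bool, (2 * c 0 ^ 4 +
            12 * c 0 ^ 2 * (∑ i : Fin n, sgn (δ i) * c i.succ) ^ 2 +
            2 * (∑ i : Fin n, sgn (δ i) * c i.succ) ^ 4) :=
          Finset.sum_congr rfl fun δ _ => by
            simp only [sgn, if_true, Bool.false_eq_true, if_false]
            ring
      _ = 2 ^ n * (2 * c 0 ^ 4) + 12 * c 0 ^ 2 * (2 ^ n * ∑ i : Fin n, c i.succ ^ 2) +
            2 * ∑ δ : Fin n → Bool, (∑ i : Fin n, sgn (δ i) * c i.succ) ^ 4 := by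
          rw [Finset.sum_add_distrib, Finset.sum_add_distrib, Finset.sum_const,
            ← Finset.mul_sum _ _ (12 * c 0 ^ 2), ← Finset.mul_sum _ _ (2 : ℝ), sum_sq_rademacher]
          simp
      _ ≤ _ := by
          have h := ih fun i => c i.succ
          have h2 : (0 : ℝ) ≤ 2 ^ n * c 0 ^ 4 := by positivity
          calc _ ≤ 2 ^ n * (2 * c 0 ^ 4) + 12 * c 0 ^ 2 * (2 ^ n * ∑ i : Fin n, c i.succ ^ 2) +
                2 * (2 ^ n * (3 * (∑ i : Fin n, c i.succ ^ 2) ^ 2)) + 4 * (2 ^ n * c 0 ^ 4) := by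
                linarith
            _ = _ := by ring

/-- The `L_1` Khintchine inequality with constant `9 / 5`. -/
lemma sqrt_sum_sq_le_rademacher {n : ℕ} (c : Fin n → ℝ) :
    √(∑ i, c i ^ 2) ≤ 9 / 5 * ((2 ^ n : ℝ)⁻¹ * ∑ δ : Fin n → Bool, |∑ i, sgn (δ i) * c i|) := by
  set r := √(∑ i, c i ^ 2) with hr
  have hr2 : r ^ 2 = ∑ i, c i ^ 2 := Real.sq_sqrt (Finset.sum_nonneg fun _ _ => sq_nonneg _)
  rcases (show 0 ≤ r from Real.sqrt_nonneg _).eq_or_lt with h0 | h0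
  · rw [← h0]
    positivity
  have hpt : ∀ s : ℝ, r ^ 2 * s ^ 2 - 4 / 27 * s ^ 4 ≤ r ^ 3 * |s| := by
    intro s
    rw [← sq_abs s, show s ^ 4 = |s| ^ 4 by rw [← abs_pow, abs_of_nonneg (by positivity)]]
    have h : 0 ≤ |s| * (4 / 27 * (|s| - 3 / 2 * r) ^ 2 * (|s| + 3 * r)) := by positivity
    linarith
  have hsum := Finset.sum_le_sum fun (δ : Fin n → Bool) (_ : δ ∈ Finset.univ) =>
    hpt (∑ i, sgn (δ i) * c i)
  rw [Finset.sum_sub_distrib, ← Finset.mul_sum, ← Finset.mul_sum, ← Finset.mul_sum,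
    sum_sq_rademacher, ← hr2] at hsum
  have h4 := sum_pow_four_rademacher_le c
  rw [← hr2] at h4
  have hN : (0 : ℝ) < 2 ^ n := by positivity
  set A := ∑ δ : Fin n → Bool, |∑ i, sgn (δ i) * c i|
  have h5 : r ^ 3 * (2 ^ n * (5 / 9 * r)) ≤ r ^ 3 * A := by linarith
  have h6 := le_of_mul_le_mul_left h5 (by positivity)
  rw [inv_mul_eq_div, ← mul_div_assoc, le_div_iff₀ hN]
  linarith

lemma sqrt_sum_sq_dual_le_radMean {X : Type*} [NormedAddCommGroup X] [NormedSpace ℝ X] {n : ℕ}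
    (v : Fin n → X) {φ : X →L[ℝ] ℝ} (hφ : ‖φ‖ ≤ 1) :
    √(∑ i, φ (v i) ^ 2) ≤ 9 / 5 * radMean v := by
  refine (sqrt_sum_sq_le_rademacher _).trans ?_
  unfold radMean
  gcongr with δ
  have h := φ.le_of_opNorm_le hφ (∑ i, sgn (δ i) • v i)
  simpa using h

lemma radMean_nonneg {X : Type*} [NormedAddCommGroup X] [NormedSpace ℝ X] {n : ℕ}
    (v : Fin n → X) : 0 ≤ radMean v := by
  unfold radMean
  positivity

lemma bder_eq {X : Type*} [AddCommGroup X] [Module ℝ X] {n : ℕ} (α : ℝ) (i : Fin n)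
    (f : (Fin n → Bool) → X) (x : Fin n → Bool) :
    bder α i f x = (if x i then 1 - α else α) • (f x - f (flipc x i)) := by
  unfold bder flipc
  cases h : x i
  · have hx : Function.update x i false = x := by rw [← h, Function.update_eq_self]
    rw [hx]
    simp only [Bool.not_false, Bool.false_eq_true, if_false]
    module
  · have hx : Function.update x i true = x := by rw [← h, Function.update_eq_self]
    rw [hx]
    simp only [Bool.not_true, if_true]
    module

lemma upGrad_norm_sub_le_radMean {X : Type*} [NormedAddCommGroup X] [NormedSpace ℝ X] {n : ℕ}
    {α κ : ℝ} (hκ : 0 < κ) (h1 : κ ≤ α) (h2 : κ ≤ 1 - α) (f : (Fin n → Bool) → X) (m : X)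
    (x : Fin n → Bool) :
    upGrad (fun x => ‖f x - m‖) x ≤ 9 / 5 / κ * radMean fun i => bder α i f x := by
  obtain ⟨φ, hφ, hφx⟩ := exists_dual_vector'' ℝ (f x - m)
  simp only [RCLike.ofReal_real_eq_id, id] at hφx
  have key : ∀ i, max (‖f x - m‖ - ‖f (flipc x i) - m‖) 0 ≤ κ⁻¹ * |φ (bder α i f x)| := by
    intro i
    refine max_le ?_ (by positivity)
    have h3 : φ (f (flipc x i) - m) ≤ ‖f (flipc x i) - m‖ :=
      (le_abs_self _).trans (by simpa using φ.le_of_opNorm_le hφ (f (flipc x i) - m))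
    rw [inv_mul_eq_div, le_div_iff₀ hκ, bder_eq, map_smul, smul_eq_mul, abs_mul]
    have h4 : κ ≤ |if x i = true then 1 - α else α| := by
      split_ifs
      · exact h2.trans (le_abs_self _)
      · exact h1.trans (le_abs_self _)
    have h5 : ‖f x - m‖ - ‖f (flipc x i) - m‖ ≤ |φ (f x - f (flipc x i))| := by
      refine le_trans ?_ (le_abs_self _)
      rw [← hφx, ← sub_sub_sub_cancel_right (f x) (f (flipc x i)) m, map_sub φ (f x - m)]
      linarith
    calc _ ≤ |φ (f x - f (flipc x i))| * κ := by gcongr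
      _ ≤ _ := by rw [mul_comm]; gcongr
  calc upGrad (fun x => ‖f x - m‖) x ≤ √(∑ i, (κ⁻¹ * |φ (bder α i f x)|) ^ 2) := by
        refine Real.sqrt_le_sqrt (Finset.sum_le_sum fun i _ => ?_)
        exact pow_le_pow_left₀ (le_max_right _ _) (key i) 2
    _ = κ⁻¹ * √(∑ i, φ (bder α i f x) ^ 2) := by
        simp only [mul_pow, sq_abs, ← Finset.mul_sum]
        rw [Real.sqrt_mul (by positivity), Real.sqrt_sq (by positivity)]
    _ ≤ κ⁻¹ * (9 / 5 * radMean fun i => bder α i f x) := by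
        gcongr
        exact sqrt_sum_sq_dual_le_radMean _ hφ
    _ = _ := by ring

lemma radMean_rpow_le {X : Type*} [NormedAddCommGroup X] [NormedSpace ℝ X] {n : ℕ}
    (v : Fin n → X) {p : ℝ} (hp : 1 ≤ p) :
    radMean v ^ p ≤ (2 ^ n : ℝ)⁻¹ * ∑ δ : Fin n → Bool, ‖∑ i, sgn (δ i) • v i‖ ^ p := by
  have h := Real.rpow_arith_mean_le_arith_mean_rpow Finset.univ
    (fun _ : Fin n → Bool => (2 ^ n : ℝ)⁻¹) (fun δ => ‖∑ i, sgn (δ i) • v i‖)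
    (fun _ _ => by positivity) (by simp) (fun _ _ => by positivity) hp
  simpa only [radMean, Finset.mul_sum] using h

lemma lpNormW_rpow {X : Type*} [NormedAddCommGroup X] {n : ℕ} {w : (Fin n → Bool) → ℝ}
    (hw : ∀ x, 0 ≤ w x) {p : ℝ} (hp : 1 ≤ p) (g : (Fin n → Bool) → X) :
    lpNormW w p g ^ p = ∑ x, w x * ‖g x‖ ^ p := by
  have h : 0 ≤ ∑ x, w x * ‖g x‖ ^ p := Finset.sum_nonneg fun x _ =>
    mul_nonneg (hw x) (by positivity)
  rw [lpNormW, ← Real.rpow_mul h, one_div_mul_cancel (by linarith), Real.rpow_one]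

lemma sum_upGrad_rpow_le {X : Type*} [NormedAddCommGroup X] [NormedSpace ℝ X] {n : ℕ}
    {α κ : ℝ} (hκ : 0 < κ) (h1 : κ ≤ α) (h2 : κ ≤ 1 - α) (f : (Fin n → Bool) → X) (m : X)
    {u : (Fin n → Bool) → ℝ} (hu : ∀ x, upGrad u x ≤ upGrad (fun x => ‖f x - m‖) x)
    {p : ℝ} (hp : 1 ≤ p) :
    (∑ x, biasedWeight (fun _ => α) x * upGrad u x ^ p) ^ (1 / p) ≤
      9 / 5 / κ * ((2 ^ n : ℝ)⁻¹ * ∑ δ : Fin n → Bool,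
        lpNormW (biasedWeight fun _ : Fin n => α) p
          (fun x => ∑ i, sgn (δ i) • bder α i f x) ^ p) ^ (1 / p) := by
  have hp0 : 0 < p := by linarith
  have hw : ∀ x : Fin n → Bool, 0 ≤ biasedWeight (fun _ => α) x := fun x =>
    (biasedWeight_pos (by linarith) (by linarith) x).le
  simp only [lpNormW_rpow hw hp]
  have hR : 0 ≤ (2 ^ n : ℝ)⁻¹ * ∑ δ : Fin n → Bool, ∑ x : Fin n → Bool,
      biasedWeight (fun _ => α) x * ‖∑ i, sgn (δ i) • bder α i f x‖ ^ p := by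
    refine mul_nonneg (by positivity) (Finset.sum_nonneg fun δ _ => Finset.sum_nonneg fun x _ => ?_)
    exact mul_nonneg (hw x) (by positivity)
  have key : ∑ x, biasedWeight (fun _ => α) x * upGrad u x ^ p ≤ (9 / 5 / κ) ^ p *
      ((2 ^ n : ℝ)⁻¹ * ∑ δ : Fin n → Bool, ∑ x : Fin n → Bool,
      biasedWeight (fun _ => α) x * ‖∑ i, sgn (δ i) • bder α i f x‖ ^ p) := by
    rw [Finset.sum_comm, Finset.mul_sum, Finset.mul_sum]
    refine Finset.sum_le_sum fun x _ => ?_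
    rw [← Finset.mul_sum, mul_left_comm _ (biasedWeight _ x), mul_left_comm _ (biasedWeight _ x)]
    refine mul_le_mul_of_nonneg_left ?_ (hw x)
    calc upGrad u x ^ p ≤ (9 / 5 / κ * radMean fun i => bder α i f x) ^ p :=
          Real.rpow_le_rpow (upGrad_nonneg _ _)
            ((hu x).trans (upGrad_norm_sub_le_radMean hκ h1 h2 f m x)) hp0.le
      _ = (9 / 5 / κ) ^ p * (radMean fun i => bder α i f x) ^ p :=
          Real.mul_rpow (by positivity) (radMean_nonneg _)
      _ ≤ _ := by gcongr; exact radMean_rpow_le _ hp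
  have hS : 0 ≤ ∑ x, biasedWeight (fun _ => α) x * upGrad u x ^ p :=
    Finset.sum_nonneg fun x _ => mul_nonneg (hw x) (Real.rpow_nonneg (upGrad_nonneg _ _) _)
  refine (Real.rpow_le_rpow hS key (by positivity)).trans ?_
  rw [Real.mul_rpow (by positivity) hR, ← Real.rpow_mul (by positivity),
    mul_one_div_cancel hp0.ne', Real.rpow_one]

lemma norm_add_smul_le_of_abs_le {X : Type*} [NormedAddCommGroup X] [NormedSpace ℝ X] {B η : ℝ}
    (hB : 0 < B) (hη : |η| ≤ B) (u v : X) :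
    ‖u + η • v‖ ≤ (‖u + B • v‖ + ‖u - B • v‖) / 2 +
      η * ((‖u + B • v‖ - ‖u - B • v‖) / (2 * B)) := by
  obtain ⟨h1, h2⟩ := abs_le.1 hη
  have e : u + η • v = ((B + η) / (2 * B)) • (u + B • v) + ((B - η) / (2 * B)) • (u - B • v) := by
    have e1 : (B + η) / (2 * B) + (B - η) / (2 * B) = 1 := by field_simp; ring
    have e2 : ((B + η) / (2 * B) - (B - η) / (2 * B)) * B = η := by field_simp; ring
    calc u + η • v = ((B + η) / (2 * B) + (B - η) / (2 * B)) • u +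
          (((B + η) / (2 * B) - (B - η) / (2 * B)) * B) • v := by rw [e1, e2, one_smul]
      _ = _ := by module
  rw [e]
  refine (norm_add_le _ _).trans (le_of_eq ?_)
  rw [norm_smul, norm_smul, Real.norm_of_nonneg (div_nonneg (by linarith) (by linarith)),
    Real.norm_of_nonneg (div_nonneg (by linarith) (by linarith))]
  field_simp
  ring

/-- Centred bounded independent coefficients are dominated by Rademacher signs. -/
lemma sum_prod_mul_norm_le_rademacher {X : Type*} [NormedAddCommGroup X] [NormedSpace ℝ X]
    {B : ℝ} (hB : 0 < B) {n : ℕ} (Q η : Fin n → Bool → ℝ) (hQ : ∀ i a, 0 ≤ Q i a)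
    (hQ1 : ∀ i, Q i true + Q i false = 1)
    (hη0 : ∀ i, Q i true * η i true + Q i false * η i false = 0) (hη : ∀ i a, |η i a| ≤ B)
    (v : Fin n → X) (z : X) :
    ∑ x : Fin n → Bool, (∏ i, Q i (x i)) * ‖z + ∑ i, η i (x i) • v i‖ ≤
      (2 ^ n : ℝ)⁻¹ * ∑ δ : Fin n → Bool, ‖z + B • ∑ i, sgn (δ i) • v i‖ := by
  induction n generalizing z with
  | zero => simp
  | succ n ih =>
    have IH := ih (fun i => Q i.succ) (fun i => η i.succ) (fun i => hQ _) (fun i => hQ1 _)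
      (fun i => hη0 _) (fun i => hη _) (fun i => v i.succ)
    set S : X → ℝ := fun z =>
      (2 ^ n : ℝ)⁻¹ * ∑ δ : Fin n → Bool, ‖z + B • ∑ i, sgn (δ i) • v i.succ‖ with hS
    have hconv : ∀ a, S (z + η 0 a • v 0) ≤ (S (z + B • v 0) + S (z - B • v 0)) / 2 +
        η 0 a * ((S (z + B • v 0) - S (z - B • v 0)) / (2 * B)) := by
      intro a
      calc S (z + η 0 a • v 0) ≤ (2 ^ n : ℝ)⁻¹ * ∑ δ : Fin n → Bool,
            ((‖z + B • v 0 + B • ∑ i, sgn (δ i) • v i.succ‖ +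
                ‖z - B • v 0 + B • ∑ i, sgn (δ i) • v i.succ‖) / 2 +
              η 0 a * ((‖z + B • v 0 + B • ∑ i, sgn (δ i) • v i.succ‖ -
                ‖z - B • v 0 + B • ∑ i, sgn (δ i) • v i.succ‖) / (2 * B))) := by
            simp only [hS]
            gcongr with δ
            have h := norm_add_smul_le_of_abs_le hB (hη 0 a)
              (z + B • ∑ i, sgn (δ i) • v i.succ) (v 0)
            rw [add_right_comm, sub_add_eq_add_sub, add_right_comm z (B • v 0)]
            exact h
        _ = _ := by
            rw [Finset.sum_add_distrib, ← Finset.sum_div, Finset.sum_add_distrib,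
              ← Finset.mul_sum, ← Finset.sum_div, Finset.sum_sub_distrib]
            simp only [hS]
            ring
    have hR : (2 ^ (n + 1) : ℝ)⁻¹ * ∑ δ : Fin (n + 1) → Bool, ‖z + B • ∑ i, sgn (δ i) • v i‖ =
        (S (z + B • v 0) + S (z - B • v 0)) / 2 := by
      rw [sum_cube_succ]
      simp only [Fin.sum_univ_succ, Fin.cons_zero, Fin.cons_succ, sgn, if_true,
        Bool.false_eq_true, if_false, one_smul, neg_smul, smul_add, smul_neg, ← add_assoc,
        ← sub_eq_add_neg, hS]
      rw [pow_succ, mul_inv]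
      ring
    rw [hR, sum_cube_succ]
    simp only [Fin.prod_univ_succ, Fin.sum_univ_succ, Fin.cons_zero, Fin.cons_succ, mul_assoc,
      ← Finset.mul_sum, ← add_assoc]
    have h1 := mul_le_mul_of_nonneg_left ((IH (z + η 0 true • v 0)).trans (hconv true)) (hQ 0 true)
    have h2 := mul_le_mul_of_nonneg_left ((IH (z + η 0 false • v 0)).trans (hconv false))
      (hQ 0 false)
    refine (add_le_add h1 h2).trans (le_of_eq ?_)
    linear_combination (S (z + B • v 0) + S (z - B • v 0)) / 2 * hQ1 0 +
      (S (z + B • v 0) - S (z - B • v 0)) / (2 * B) * hη0 0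

lemma sum_prod_mul_norm_le_sum {X : Type*} [NormedAddCommGroup X] [NormedSpace ℝ X]
    {c : ℝ} {n : ℕ} (Q η : Fin n → Bool → ℝ) (hQ : ∀ i a, 0 ≤ Q i a)
    (hQ1 : ∀ i, Q i true + Q i false = 1)
    (hη : ∀ i, Q i true * |η i true| + Q i false * |η i false| ≤ c)
    (v : Fin n → X) (z : X) :
    ∑ x : Fin n → Bool, (∏ i, Q i (x i)) * ‖z + ∑ i, η i (x i) • v i‖ ≤
      ‖z‖ + c * ∑ i, ‖v i‖ := by
  induction n generalizing z with
  | zero => simp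
  | succ n ih =>
    have IH := ih (fun i => Q i.succ) (fun i => η i.succ) (fun i => hQ _) (fun i => hQ1 _)
      (fun i => hη _) (fun i => v i.succ)
    have hz : ∀ a, ‖z + η 0 a • v 0‖ ≤ ‖z‖ + |η 0 a| * ‖v 0‖ := fun a =>
      (norm_add_le _ _).trans (by rw [norm_smul, Real.norm_eq_abs])
    rw [sum_cube_succ]
    simp only [Fin.prod_univ_succ, Fin.sum_univ_succ, Fin.cons_zero, Fin.cons_succ, mul_assoc,
      ← Finset.mul_sum, ← add_assoc]
    have h1 := mul_le_mul_of_nonneg_left ((IH (z + η 0 true • v 0)).trans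
      (add_le_add_left (hz true) _)) (hQ 0 true)
    have h2 := mul_le_mul_of_nonneg_left ((IH (z + η 0 false • v 0)).trans
      (add_le_add_left (hz false) _)) (hQ 0 false)
    refine (add_le_add h1 h2).trans ?_
    have h3 := mul_le_mul_of_nonneg_right (hη 0) (norm_nonneg (v 0))
    calc _ = (Q 0 true + Q 0 false) * (‖z‖ + c * ∑ i : Fin n, ‖v i.succ‖) +
          (Q 0 true * |η 0 true| + Q 0 false * |η 0 false|) * ‖v 0‖ := by ring
      _ ≤ _ := by rw [hQ1]; linarith

lemma norm_le_radMean {X : Type*} [NormedAddCommGroup X] [NormedSpace ℝ X] {n : ℕ}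
    (v : Fin n → X) (i : Fin n) : ‖v i‖ ≤ 9 / 5 * radMean v := by
  obtain ⟨φ, hφ, hφx⟩ := exists_dual_vector'' ℝ (v i)
  simp only [RCLike.ofReal_real_eq_id, id] at hφx
  refine le_trans ?_ (sqrt_sum_sq_dual_le_radMean v hφ)
  refine Real.le_sqrt_of_sq_le ?_
  rw [← hφx]
  exact Finset.single_le_sum (f := fun j => φ (v j) ^ 2) (fun _ _ => sq_nonneg _)
    (Finset.mem_univ i)

/-- The one-coordinate marginal of the biased measure. -/
def coordWeight (α : ℝ) (b : Bool) : ℝ := if b then α else 1 - α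

/-- The kernel keeping a coordinate with probability `r` and resampling it otherwise. -/
def noiseKernel (α r : ℝ) (a b : Bool) : ℝ :=
  r * (if a = b then 1 else 0) + (1 - r) * coordWeight α b

/-- The derivative of `noiseKernel` in its noise parameter. -/
def noiseDiff (α : ℝ) (a b : Bool) : ℝ := (if a = b then 1 else 0) - coordWeight α b

/-- The part of the derivative of the product noise kernel coming from coordinate `i`. -/
def noiseDiffAt {n : ℕ} (α r : ℝ) (i : Fin n) (x y : Fin n → Bool) : ℝ :=
  (∏ j ∈ Finset.univ.erase i, noiseKernel α r (x j) (y j)) * noiseDiff α (x i) (y i)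

lemma biasedWeight_eq_prod {n : ℕ} (α : ℝ) (x : Fin n → Bool) :
    biasedWeight (fun _ => α) x = ∏ i, coordWeight α (x i) := rfl

lemma coordWeight_mul_noiseKernel (α r : ℝ) (a b : Bool) :
    coordWeight α a * noiseKernel α r a b = coordWeight α b * noiseKernel α r b a := by
  cases a <;> cases b <;> simp [coordWeight, noiseKernel] <;> ring

lemma coordWeight_mul_noiseDiff (α : ℝ) (a b : Bool) :
    coordWeight α a * noiseDiff α a b = coordWeight α b * noiseDiff α b a := by
  cases a <;> cases b <;> simp [coordWeight, noiseDiff] <;> ring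

lemma noiseKernel_sum (α r : ℝ) (a : Bool) :
    noiseKernel α r a true + noiseKernel α r a false = 1 := by
  cases a <;> simp [coordWeight, noiseKernel] <;> ring

lemma noiseDiff_sum (α : ℝ) (a : Bool) : noiseDiff α a true + noiseDiff α a false = 0 := by
  cases a <;> simp [coordWeight, noiseDiff]

lemma noiseDiff_add_not (α : ℝ) (a b : Bool) : noiseDiff α a b + noiseDiff α a (!b) = 0 := by
  cases a <;> cases b <;> simp [coordWeight, noiseDiff]

lemma biasedWeight_mul_noiseDiffAt {n : ℕ} (α r : ℝ) (i : Fin n) (x y : Fin n → Bool) :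
    biasedWeight (fun _ => α) x * noiseDiffAt α r i x y =
      biasedWeight (fun _ => α) y * noiseDiffAt α r i y x := by
  have key : ∀ x y : Fin n → Bool, biasedWeight (fun _ => α) x * noiseDiffAt α r i x y =
      (∏ j ∈ Finset.univ.erase i, coordWeight α (x j) * noiseKernel α r (x j) (y j)) *
        (coordWeight α (x i) * noiseDiff α (x i) (y i)) := by
    intro x y
    rw [biasedWeight_eq_prod, ← Finset.mul_prod_erase _ _ (Finset.mem_univ i), noiseDiffAt,
      Finset.prod_mul_distrib]
    ring
  rw [key, key, coordWeight_mul_noiseDiff]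
  simp only [coordWeight_mul_noiseKernel α r (x _)]

lemma hasDerivAt_prod_noiseKernel {n : ℕ} (α r : ℝ) (x y : Fin n → Bool) :
    HasDerivAt (fun r => ∏ i, noiseKernel α r (x i) (y i)) (∑ i, noiseDiffAt α r i x y) r := by
  have h : ∀ i : Fin n, HasDerivAt (fun r => noiseKernel α r (x i) (y i))
      (noiseDiff α (x i) (y i)) r := by
    intro i
    refine (((hasDerivAt_id r).mul_const _).add
      (((hasDerivAt_id r).const_sub 1).mul_const _)).congr_deriv ?_
    rw [noiseDiff]
    ring
  simpa [noiseDiffAt] using HasDerivAt.fun_finsetProd (u := Finset.univ) fun i _ => h i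

lemma flipc_flipc {n : ℕ} (x : Fin n → Bool) (i : Fin n) : flipc (flipc x i) i = x := by
  simp [flipc]

lemma noiseDiffAt_add_flipc {n : ℕ} (α r : ℝ) (i : Fin n) (x y : Fin n → Bool) :
    noiseDiffAt α r i x y + noiseDiffAt α r i x (flipc y i) = 0 := by
  have h : ∏ j ∈ Finset.univ.erase i, noiseKernel α r (x j) (flipc y i j) =
      ∏ j ∈ Finset.univ.erase i, noiseKernel α r (x j) (y j) :=
    Finset.prod_congr rfl fun j hj => by simp [flipc, Finset.ne_of_mem_erase hj]
  rw [noiseDiffAt, noiseDiffAt, h, ← mul_add]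
  simp only [flipc, Function.update_self, noiseDiff_add_not, mul_zero]

lemma sum_noiseDiffAt_mul_bder {X : Type*} [NormedAddCommGroup X] [NormedSpace ℝ X] {n : ℕ}
    (α r : ℝ) (i : Fin n) (x : Fin n → Bool) (f : (Fin n → Bool) → X) (φ : X →L[ℝ] ℝ) :
    ∑ y, noiseDiffAt α r i x y * φ (f y) = ∑ y, noiseDiffAt α r i x y * φ (bder α i f y) := by
  set G : (Fin n → Bool) → ℝ := fun y => φ (f y - bder α i f y) with hG
  have hGf : ∀ y, G (flipc y i) = G y := fun y => by simp [hG, bder, flipc]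
  have h0 : ∑ y, noiseDiffAt α r i x y * G y = 0 := by
    have h1 : ∑ y, noiseDiffAt α r i x (flipc y i) * G (flipc y i) =
        ∑ y, noiseDiffAt α r i x y * G y :=
      Equiv.sum_comp (Function.Involutive.toPerm (fun y => flipc y i) fun y => flipc_flipc y i)
        fun y => noiseDiffAt α r i x y * G y
    have h2 : ∑ y, noiseDiffAt α r i x y * G y +
        ∑ y, noiseDiffAt α r i x (flipc y i) * G (flipc y i) = 0 := by
      rw [← Finset.sum_add_distrib]
      refine Finset.sum_eq_zero fun y _ => ?_
      rw [hGf, ← add_mul, noiseDiffAt_add_flipc, zero_mul]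
    linarith
  rw [← sub_eq_zero, ← Finset.sum_sub_distrib, ← h0]
  exact Finset.sum_congr rfl fun y _ => by simp only [hG, map_sub]; ring

/-- The derivative of the interpolation along the noise semigroup, bounded by dual functionals
in the unit ball. -/
lemma sum_noiseDiffAt_le {X : Type*} [NormedAddCommGroup X] [NormedSpace ℝ X] {n : ℕ}
    {α : ℝ} (hα0 : 0 < α) (hα1 : α < 1) (r : ℝ) (f : (Fin n → Bool) → X)
    (φ : (Fin n → Bool) → X →L[ℝ] ℝ) (hφ : ∀ x, ‖φ x‖ ≤ 1) :
    ∑ x, ∑ y, biasedWeight (fun _ => α) x * ((∑ i, noiseDiffAt α r i x y) * φ x (f y)) ≤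
      ∑ y, biasedWeight (fun _ => α) y *
        ∑ x, ‖∑ i, noiseDiffAt α r i y x • bder α i f y‖ := by
  calc _ = ∑ x, ∑ y, ∑ i, biasedWeight (fun _ => α) x *
        (noiseDiffAt α r i x y * φ x (bder α i f y)) := by
        refine Finset.sum_congr rfl fun x _ => ?_
        rw [← Finset.mul_sum]
        simp only [Finset.sum_mul]
        rw [Finset.sum_comm]
        rw [Finset.sum_congr rfl fun i _ => sum_noiseDiffAt_mul_bder α r i x f (φ x),
          Finset.sum_comm, Finset.mul_sum]
        simp only [Finset.mul_sum]
    _ = ∑ y, ∑ x, biasedWeight (fun _ => α) y *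
        φ x (∑ i, noiseDiffAt α r i y x • bder α i f y) := by
        rw [Finset.sum_comm]
        refine Finset.sum_congr rfl fun y _ => Finset.sum_congr rfl fun x _ => ?_
        rw [map_sum, Finset.mul_sum]
        refine Finset.sum_congr rfl fun i _ => ?_
        rw [← mul_assoc, biasedWeight_mul_noiseDiffAt, mul_assoc, map_smul, smul_eq_mul]
    _ ≤ _ := by
        refine Finset.sum_le_sum fun y _ => ?_
        rw [← Finset.mul_sum]
        refine mul_le_mul_of_nonneg_left (Finset.sum_le_sum fun x _ => ?_)
          (biasedWeight_pos hα0 hα1 y).le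
        refine (le_abs_self _).trans ?_
        simpa using (φ x).le_of_opNorm_le (hφ x) (∑ i, noiseDiffAt α r i y x • bder α i f y)

lemma noiseKernel_pos {α r : ℝ} (hα0 : 0 < α) (hα1 : α < 1) (hr0 : 0 < r) (hr1 : r < 1)
    (a b : Bool) : 0 < noiseKernel α r a b := by
  have h : 0 < coordWeight α b := by unfold coordWeight; split_ifs <;> linarith
  have h2 : 0 < (1 - r) * coordWeight α b := mul_pos (by linarith) h
  unfold noiseKernel
  split_ifs <;> linarith

lemma sum_norm_noiseDiffAt_le {X : Type*} [NormedAddCommGroup X] [NormedSpace ℝ X] {n : ℕ}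
    {α κ r : ℝ} (hκ : 0 < κ) (h1 : κ ≤ α) (h2 : κ ≤ 1 - α) (hr0 : 0 < r) (hr1 : r < 1)
    (y : Fin n → Bool) (v : Fin n → X) :
    ∑ x, ‖∑ i, noiseDiffAt α r i y x • v i‖ ≤ κ⁻¹ / (1 - r) * radMean v ∧
    ∑ x, ‖∑ i, noiseDiffAt α r i y x • v i‖ ≤ 4 * n * radMean v := by
  have hα0 : 0 < α := by linarith
  have hα1 : α < 1 := by linarith
  set Q : Fin n → Bool → ℝ := fun i a => noiseKernel α r (y i) a with hQ
  have hQ0 : ∀ i a, 0 < Q i a := fun i a => noiseKernel_pos hα0 hα1 hr0 hr1 _ _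
  have hQ1 : ∀ i, Q i true + Q i false = 1 := fun i => noiseKernel_sum _ _ _
  set η : Fin n → Bool → ℝ := fun i a => noiseDiff α (y i) a / noiseKernel α r (y i) a with hη
  have hQη : ∀ i a, Q i a * η i a = noiseDiff α (y i) a := fun i a =>
    mul_div_cancel₀ _ (hQ0 i a).ne'
  have hQaη : ∀ i a, Q i a * |η i a| = |noiseDiff α (y i) a| := fun i a => by
    rw [← hQη, abs_mul, abs_of_pos (hQ0 i a)]
  have e : ∑ x, ‖∑ i, noiseDiffAt α r i y x • v i‖ =
      ∑ x : Fin n → Bool, (∏ i, Q i (x i)) * ‖0 + ∑ i, η i (x i) • v i‖ := by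
    refine Finset.sum_congr rfl fun x _ => ?_
    have hP : 0 ≤ ∏ i, Q i (x i) := Finset.prod_nonneg fun i _ => (hQ0 i _).le
    rw [zero_add, ← Real.norm_of_nonneg hP, ← norm_smul, Finset.smul_sum]
    congr 1
    refine Finset.sum_congr rfl fun i _ => ?_
    rw [smul_smul, ← Finset.prod_erase_mul _ _ (Finset.mem_univ i), mul_assoc, hQη, noiseDiffAt]
  rw [e]
  constructor
  · have hB : 0 < κ⁻¹ / (1 - r) := div_pos (by positivity) (by linarith)
    refine (sum_prod_mul_norm_le_rademacher hB Q η (fun i a => (hQ0 i a).le) hQ1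
      (fun i => by rw [hQη, hQη, noiseDiff_sum]) (fun i a => ?_) v 0).trans (le_of_eq ?_)
    · have hd : |noiseDiff α (y i) a| ≤ κ⁻¹ / (1 - r) * Q i a := by
        rw [div_mul_eq_mul_div, inv_mul_eq_div, div_div, le_div_iff₀ (mul_pos hκ (by linarith))]
        simp only [hQ, noiseKernel, noiseDiff]
        have hc : κ ≤ coordWeight α a ∧ coordWeight α a ≤ 1 := by
          unfold coordWeight
          split_ifs <;> constructor <;> linarith
        split_ifs
        · rw [abs_of_nonneg (by linarith)]
          nlinarith [mul_pos hκ (sub_pos.2 hr1)]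
        · rw [zero_sub, abs_neg, abs_of_nonneg (by linarith)]
          nlinarith [mul_pos hκ (sub_pos.2 hr1)]
      rw [← hQaη, mul_comm] at hd
      exact le_of_mul_le_mul_right hd (hQ0 i a)
    · simp only [zero_add, norm_smul, Real.norm_of_nonneg hB.le, ← Finset.mul_sum, radMean]
      ring
  · refine (sum_prod_mul_norm_le_sum (c := 2) Q η (fun i a => (hQ0 i a).le) hQ1
      (fun i => ?_) v 0).trans ?_
    · rw [hQaη, hQaη]
      have hd : ∀ a, |noiseDiff α (y i) a| ≤ 1 := by
        intro a
        rw [abs_le]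
        unfold noiseDiff coordWeight
        split_ifs <;> constructor <;> linarith
      linarith [hd true, hd false]
    · have hs : ∑ i, ‖v i‖ ≤ ∑ _i : Fin n, 9 / 5 * radMean v :=
        Finset.sum_le_sum fun i _ => norm_le_radMean v i
      have hR : 0 ≤ n * radMean v := mul_nonneg (by positivity) (radMean_nonneg v)
      rw [Finset.sum_const, Finset.card_fin, nsmul_eq_mul] at hs
      rw [norm_zero]
      linarith

/-- Pisier's inequality in `L_1` on the biased cube, with a logarithmic loss. -/
lemma sum_norm_sub_mean_le {X : Type*} [NormedAddCommGroup X] [NormedSpace ℝ X] {n : ℕ}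
    {α κ : ℝ} (hκ : 0 < κ) (h1 : κ ≤ α) (h2 : κ ≤ 1 - α) (f : (Fin n → Bool) → X) :
    ∑ x, biasedWeight (fun _ => α) x * ‖f x - ∑ y, biasedWeight (fun _ => α) y • f y‖ ≤
      (κ⁻¹ + 4) * (Real.log n + 1) *
        ∑ x, biasedWeight (fun _ => α) x * radMean fun i => bder α i f x := by
  have hα0 : 0 < α := by linarith
  have hα1 : α < 1 := by linarith
  set w : (Fin n → Bool) → ℝ := biasedWeight fun _ => α with hw
  have hwp : ∀ y, 0 ≤ w y := fun y => (biasedWeight_pos hα0 hα1 y).le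
  set m := ∑ y, w y • f y with hm
  set R := ∑ x, w x * radMean fun i => bder α i f x with hR
  have hR0 : 0 ≤ R := Finset.sum_nonneg fun x _ => mul_nonneg (hwp x) (radMean_nonneg _)
  rcases Nat.eq_zero_or_pos n with rfl | hn
  · have : ∀ x, f x - m = 0 := fun x => by
      rw [hm, Fintype.sum_subsingleton _ x, hw, biasedWeight]
      simp
    simp only [this, norm_zero, mul_zero, Finset.sum_const_zero]
    simp only [CharP.cast_eq_zero, Real.log_zero, zero_add, mul_one]
    positivity
  choose φ hφ hφx using fun x => exists_dual_vector'' ℝ (f x - m)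
  simp only [RCLike.ofReal_real_eq_id, id] at hφx
  set θ : ℝ → ℝ := fun r =>
    ∑ x, ∑ y, w x * ((∏ i, noiseKernel α r (x i) (y i)) * φ x (f y)) with hθ
  have hθ1 : θ 1 = ∑ x, w x * φ x (f x) := by
    refine Finset.sum_congr rfl fun x _ => ?_
    rw [Finset.sum_eq_single x (fun y _ hy => ?_) (by simp)]
    · simp [noiseKernel]
    · obtain ⟨i, hi⟩ := Function.ne_iff.1 hy
      rw [Finset.prod_eq_zero (Finset.mem_univ i) (by simp [noiseKernel, Ne.symm hi])]
      simp
  have hθ0 : θ 0 = ∑ x, w x * φ x m := by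
    refine Finset.sum_congr rfl fun x _ => ?_
    rw [← Finset.mul_sum, hm, map_sum]
    congr 1
    refine Finset.sum_congr rfl fun y _ => ?_
    rw [map_smul, smul_eq_mul, hw, biasedWeight_eq_prod]
    simp [noiseKernel]
  have hgoal : ∑ x, w x * ‖f x - m‖ = θ 1 - θ 0 := by
    rw [hθ1, hθ0, ← Finset.sum_sub_distrib]
    exact Finset.sum_congr rfl fun x _ => by rw [← hφx, map_sub, mul_sub]
  have hder : ∀ r, HasDerivAt θ
      (∑ x, ∑ y, w x * ((∑ i, noiseDiffAt α r i x y) * φ x (f y))) r := fun r =>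
    HasDerivAt.fun_sum fun x _ => HasDerivAt.fun_sum fun y _ =>
      ((hasDerivAt_prod_noiseKernel α r x y).mul_const _).const_mul _
  have hbound : ∀ r, 0 < r → r < 1 →
      deriv θ r ≤ κ⁻¹ / (1 - r) * R ∧ deriv θ r ≤ 4 * n * R := by
    intro r hr0 hr1
    rw [(hder r).deriv]
    constructor <;> refine (sum_noiseDiffAt_le hα0 hα1 r f φ hφ).trans ?_ <;>
      rw [hR, Finset.mul_sum] <;> refine Finset.sum_le_sum fun y _ => ?_ <;>
      rw [mul_left_comm _ (w y)] <;> refine mul_le_mul_of_nonneg_left ?_ (hwp y)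
    · exact (sum_norm_noiseDiffAt_le hκ h1 h2 hr0 hr1 y _).1
    · exact (sum_norm_noiseDiffAt_le hκ h1 h2 hr0 hr1 y _).2
  have hn1 : (1 : ℝ) ≤ n := by exact_mod_cast hn
  set t : ℝ := 1 - 1 / n with ht
  have hn2 : 1 / (n : ℝ) ≤ 1 := (div_le_one (by linarith)).2 hn1
  have hn3 : 0 < 1 / (n : ℝ) := by positivity
  have ht0 : 0 ≤ t := by linarith
  have ht1 : t < 1 := by linarith
  have hdiff : Differentiable ℝ θ := fun r => (hder r).differentiableAt
  have hA : θ 1 - θ t ≤ 4 * n * R * (1 - t) := by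
    refine Convex.image_sub_le_mul_sub_of_deriv_le (convex_Icc t 1) hdiff.continuous.continuousOn
      hdiff.differentiableOn (fun r hr => ?_) t ⟨le_rfl, ht1.le⟩ 1 ⟨ht1.le, le_rfl⟩ ht1.le
    rw [interior_Icc] at hr
    exact (hbound r (ht0.trans_lt hr.1) hr.2).2
  have hB : θ t + κ⁻¹ * R * Real.log (1 - t) - (θ 0 + κ⁻¹ * R * Real.log (1 - 0)) ≤
      0 * (t - 0) := by
    have hder' : ∀ r < 1, HasDerivAt (fun r => θ r + κ⁻¹ * R * Real.log (1 - r))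
        (deriv θ r + κ⁻¹ * R * (-1 / (1 - r))) r := fun r hr =>
      (hdiff r).hasDerivAt.add
        ((((hasDerivAt_id r).const_sub 1).log (sub_pos.2 hr).ne').const_mul _)
    refine Convex.image_sub_le_mul_sub_of_deriv_le
      (f := fun r => θ r + κ⁻¹ * R * Real.log (1 - r)) (convex_Icc 0 t)
      (fun r hr => (hder' r (hr.2.trans_lt ht1)).continuousAt.continuousWithinAt)
      (fun r hr => ?_) (fun r hr => ?_) 0 ⟨le_rfl, ht0⟩ t ⟨ht0, le_rfl⟩ ht0
    · rw [interior_Icc] at hr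
      exact (hder' r (hr.2.trans ht1)).differentiableAt.differentiableWithinAt
    · rw [interior_Icc] at hr
      rw [(hder' r (hr.2.trans ht1)).deriv]
      have h3 := (hbound r hr.1 (hr.2.trans ht1)).1
      have h4 : κ⁻¹ / (1 - r) * R + κ⁻¹ * R * (-1 / (1 - r)) = 0 := by ring
      linarith
  have hlog : Real.log (1 - t) = -Real.log n := by
    rw [ht, sub_sub_cancel, one_div, Real.log_inv]
  rw [hlog, sub_zero, Real.log_one] at hB
  have h5 : 4 * n * R * (1 - t) = 4 * R := by
    rw [ht]
    field_simp
    ring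
  have hL : 0 ≤ Real.log n := Real.log_nonneg hn1
  have h6 : 0 ≤ Real.log n * R := mul_nonneg hL hR0
  have h7 : 0 ≤ κ⁻¹ * R := by positivity
  rw [hgoal]
  linarith

lemma sum_radMean_eq {X : Type*} [NormedAddCommGroup X] [NormedSpace ℝ X] {n : ℕ} (α : ℝ)
    (f : (Fin n → Bool) → X) :
    (2 ^ n : ℝ)⁻¹ * ∑ δ : Fin n → Bool, lpNormW (biasedWeight fun _ : Fin n => α) 1
      (fun x => ∑ i, sgn (δ i) • bder α i f x) =
      ∑ x, biasedWeight (fun _ => α) x * radMean fun i => bder α i f x := by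
  simp only [lpNormW, div_one, Real.rpow_one, radMean]
  rw [Finset.sum_comm, Finset.mul_sum]
  refine Finset.sum_congr rfl fun x _ => ?_
  rw [← Finset.mul_sum]
  ring

lemma youngFun_quarter_le {p : ℝ} (hp : 1 ≤ p) : youngFun p (1 / 4) ≤ 1 / 2 := by
  have h1 : Real.log (Real.exp 1 + (1 / 4 : ℝ) ^ p) ≤ 4 := by
    rw [Real.log_le_iff_le_exp (by positivity)]
    have h := Real.rpow_le_one (by norm_num : (0 : ℝ) ≤ 1 / 4) (by norm_num) (by linarith : 0 ≤ p)
    have h2 : Real.exp 1 + 1 ≤ Real.exp 2 := by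
      rw [show (2 : ℝ) = 1 + 1 by norm_num, Real.exp_add]
      nlinarith [Real.add_one_le_exp 1]
    have h3 : Real.exp 2 ≤ Real.exp 4 := Real.exp_le_exp.2 (by norm_num)
    linarith
  calc youngFun p (1 / 4) ≤ (1 / 4) ^ p * 4 ^ (p / 2) := by
        unfold youngFun
        have := one_le_log_exp_add (p := p) (s := 1 / 4) (by norm_num)
        gcongr
    _ = (1 / 2) ^ p := by
        rw [show (4 : ℝ) ^ (p / 2) = 2 ^ p by
            rw [show (4 : ℝ) = 2 ^ (2 : ℝ) by norm_num, ← Real.rpow_mul (by norm_num)]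
            ring_nf,
          ← Real.mul_rpow (by norm_num) (by norm_num)]
        norm_num
    _ ≤ 1 / 2 := by
        simpa using Real.rpow_le_rpow_of_exponent_ge (by norm_num : (0 : ℝ) < 1 / 2)
          (by norm_num) hp

lemma orliczNormW_le {X : Type*} [NormedAddCommGroup X] {n : ℕ} (w : (Fin n → Bool) → ℝ) {p γ : ℝ}
    (g : (Fin n → Bool) → X) (hγ : 0 < γ) (h : ∑ x, w x * youngFun p (‖g x‖ / γ) ≤ 1) :
    orliczNormW w p g ≤ γ := by
  refine csInf_le ⟨0, fun c hc => hc.1.le⟩ ⟨hγ, le_trans (le_of_eq ?_) h⟩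
  refine Finset.sum_congr rfl fun x _ => ?_
  rw [youngFun, Real.div_rpow (norm_nonneg _) hγ.le, mul_assoc]

/-- Truncating at a large multiple of the mean reduces the Orlicz bound to functions with small
support. -/
lemma sum_youngFun_norm_le_one {α K : ℝ} (hα0 : 0 < α) (hα1 : α < 1) (hK0 : 0 ≤ K)
    (hK : (1 - α) / α ≤ K ^ 2) (hK' : α / (1 - α) ≤ K ^ 2) {p : ℝ} (hp : 1 ≤ p) {n : ℕ}
    {h : (Fin n → Bool) → ℝ} (hh : ∀ x, 0 ≤ h x) {γ : ℝ} (hγ0 : 0 < γ)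
    (hmean : 8 * (Real.exp 35 * ∑ x, biasedWeight (fun _ => α) x * h x) ≤ γ)
    (hgrad : ∀ u : (Fin n → Bool) → ℝ, (∀ x, upGrad u x ≤ upGrad h x) →
      192 * K * (p + p * (p - 1) / 2) *
        (∑ x, biasedWeight (fun _ => α) x * upGrad u x ^ p) ^ (1 / p) < γ / 4) :
    ∑ x, biasedWeight (fun _ => α) x * youngFun p (h x / γ) ≤ 1 := by
  set w : (Fin n → Bool) → ℝ := biasedWeight fun _ => α with hw
  have hwp : ∀ y, 0 < w y := fun y => biasedWeight_pos hα0 hα1 y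
  set E := ∑ x, w x * h x with hE
  have hE0 : 0 ≤ E := Finset.sum_nonneg fun x _ => mul_nonneg (hwp x).le (hh x)
  set a := Real.exp 35 * E with ha
  have ha0 : 0 ≤ a := by positivity
  set u : (Fin n → Bool) → ℝ := fun x => max (h x - a) 0 with hu
  have hu0 : ∀ x, 0 ≤ u x := fun x => le_max_right _ _
  have hugrad : ∀ x, upGrad u x ≤ upGrad h x := fun x => by
    have := upGrad_le_mul (g := u) (u := h) (x := x) zero_le_one fun i => by
      rw [one_mul]
      refine max_le ?_ (le_max_right _ _)
      simp only [hu]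
      rcases le_total (h x - a) 0 with h1 | h1
      · rw [max_eq_right h1]
        linarith [le_max_right (h (flipc x i) - a) 0, le_max_right (h x - h (flipc x i)) 0]
      · rw [max_eq_left h1]
        linarith [le_max_left (h (flipc x i) - a) 0, le_max_left (h x - h (flipc x i)) 0]
    rwa [one_mul] at this
  have hsupp : ∑ x, w x * (if 0 < u x then 1 else 0) ≤ Real.exp (-35) := by
    rcases hE0.eq_or_lt with h0 | h0
    · have hz : ∀ x, h x = 0 := fun x => by
        have := (Finset.sum_eq_zero_iff_of_nonneg fun x _ =>
          mul_nonneg (hwp x).le (hh x)).1 h0.symm x (Finset.mem_univ x)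
        exact (mul_eq_zero.1 this).resolve_left (hwp x).ne'
      have : ∀ x, ¬ 0 < u x := fun x => by simp [hu, hz x, ha0]
      simp only [this, if_false, mul_zero, Finset.sum_const_zero]
      positivity
    · have hle : a * ∑ x, w x * (if 0 < u x then 1 else 0) ≤ E := by
        rw [hE, Finset.mul_sum]
        refine Finset.sum_le_sum fun x _ => ?_
        rw [mul_left_comm]
        refine mul_le_mul_of_nonneg_left ?_ (hwp x).le
        split_ifs with hx
        · have : 0 < h x - a := by simpa [hu] using hx
          linarith
        · simpa using hh x
      rw [Real.exp_neg, ← one_div, le_div_iff₀ (Real.exp_pos _)]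
      have h3 : (∑ x, w x * (if 0 < u x then 1 else 0)) * Real.exp 35 * E ≤ 1 * E := by
        linarith
      exact le_of_mul_le_mul_right h3 h0
  have hmain := sum_youngFun_div_le_one hα0 hα1 hK0 hK hK' hp hu0 hsupp
    (by positivity : 0 < γ / 4) (hgrad u hugrad)
  have hpt : ∀ x, youngFun p (h x / γ) ≤ 1 / 2 * youngFun p (u x / (γ / 4)) + 1 / 2 := by
    intro x
    have hq : 0 ≤ u x / (γ / 4) := div_nonneg (hu0 x) (by positivity)
    have hY := youngFun_nonneg (p := p) hq
    have hxa : h x ≤ u x + a := by linarith [le_max_left (h x - a) 0]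
    rcases le_total a (u x) with h1 | h1
    · have h2 : youngFun p (h x / γ) ≤ youngFun p (1 / 2 * (u x / (γ / 4))) := by
        refine youngFun_mono hp (div_nonneg (hh x) hγ0.le) ?_
        rw [show 1 / 2 * (u x / (γ / 4)) = 2 * u x / γ by ring]
        gcongr
        linarith
      linarith [youngFun_mul_le hp (by norm_num : (0 : ℝ) ≤ 1 / 2) (by norm_num) hq]
    · have h2 : youngFun p (h x / γ) ≤ youngFun p (1 / 4) := by
        refine youngFun_mono hp (div_nonneg (hh x) hγ0.le) ?_
        rw [div_le_iff₀ hγ0]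
        linarith
      linarith [youngFun_quarter_le hp]
  calc _ ≤ ∑ x, w x * (1 / 2 * youngFun p (u x / (γ / 4)) + 1 / 2) :=
        Finset.sum_le_sum fun x _ => mul_le_mul_of_nonneg_left (hpt x) (hwp x).le
    _ = 1 / 2 * ∑ x, w x * youngFun p (u x / (γ / 4)) + 1 / 2 * ∑ x, w x := by
        rw [Finset.mul_sum, Finset.mul_sum, ← Finset.sum_add_distrib]
        exact Finset.sum_congr rfl fun x _ => by ring
    _ ≤ 1 := by
        rw [hw, sum_biasedWeight]
        linarith

/-- Biased Pisier--Talagrand inequality with a `log n` correction term,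
for an arbitrary normed space `X`. The constant `C` depends only on `α` and the
constant `K` depends only on `p` and `α`. -/
theorem stmt1 (α : ℝ) (hα0 : 0 < α) (hα1 : α < 1) :
    ∃ C : ℝ, 0 < C ∧
      ∀ (p : ℝ), 1 ≤ p →
      ∃ K : ℝ, 0 < K ∧
      ∀ (X : Type) [NormedAddCommGroup X] [NormedSpace ℝ X],
      ∀ (n : ℕ) (f : (Fin n → Bool) → X),
      orliczNormW (biasedWeight fun _ : Fin n => α) p
          (fun x => f x - ∑ y : Fin n → Bool, biasedWeight (fun _ : Fin n => α) y • f y) ≤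
        K * ((2 ^ n : ℝ)⁻¹ * ∑ δ : Fin n → Bool,
            lpNormW (biasedWeight fun _ : Fin n => α) p
              (fun x => ∑ i, sgn (δ i) • bder α i f x) ^ p) ^ (1 / p) +
        C * (Real.log n + 1) * ((2 ^ n : ℝ)⁻¹ * ∑ δ : Fin n → Bool,
            lpNormW (biasedWeight fun _ : Fin n => α) 1
              (fun x => ∑ i, sgn (δ i) • bder α i f x)) := by
  set κ := min α (1 - α) with hκdef
  have hκ : 0 < κ := lt_min hα0 (by linarith)
  have hκ1 : κ ≤ α := min_le_left _ _
  have hκ2 : κ ≤ 1 - α := min_le_right _ _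
  have hB : 0 < κ⁻¹ := inv_pos.2 hκ
  have hsq : ∀ {s t : ℝ}, κ ≤ t → 0 < s → s < 1 → s / t ≤ κ⁻¹ ^ 2 := by
    intro s t hst hs0 hs1
    have h1 : s / t ≤ κ⁻¹ := by
      rw [div_le_iff₀ (hκ.trans_le hst), inv_mul_eq_div, le_div_iff₀ hκ]
      nlinarith
    have h2 : 1 ≤ κ⁻¹ := (one_le_inv₀ hκ).2 (by linarith)
    nlinarith
  refine ⟨8 * Real.exp 35 * (κ⁻¹ + 4), by positivity, fun p hp => ?_⟩
  have hm : 0 < p + p * (p - 1) / 2 := by nlinarith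
  refine ⟨4 * (192 * κ⁻¹ * (p + p * (p - 1) / 2)) * (9 / 5 / κ), by positivity, ?_⟩
  intro X _ _ n f
  rw [sum_radMean_eq]
  set m := ∑ y : Fin n → Bool, biasedWeight (fun _ : Fin n => α) y • f y with hmdef
  set R := ∑ x, biasedWeight (fun _ => α) x * radMean fun i => bder α i f x with hR
  set Rp := ((2 ^ n : ℝ)⁻¹ * ∑ δ : Fin n → Bool,
    lpNormW (biasedWeight fun _ : Fin n => α) p
      (fun x => ∑ i, sgn (δ i) • bder α i f x) ^ p) ^ (1 / p) with hRp
  have hwp : ∀ y : Fin n → Bool, 0 ≤ biasedWeight (fun _ => α) y :=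
    fun y => (biasedWeight_pos hα0 hα1 y).le
  have hR0 : 0 ≤ R := Finset.sum_nonneg fun x _ => mul_nonneg (hwp x) (radMean_nonneg _)
  have hRp0 : 0 ≤ Rp := by
    refine Real.rpow_nonneg (mul_nonneg (by positivity) (Finset.sum_nonneg fun δ _ => ?_)) _
    rw [lpNormW_rpow hwp hp]
    exact Finset.sum_nonneg fun x _ => mul_nonneg (hwp x) (by positivity)
  have hL : 0 ≤ Real.log n := Real.log_natCast_nonneg n
  refine le_of_forall_gt_imp_ge_of_dense fun γ hγ => ?_
  have hP1 : 0 ≤ 4 * (192 * κ⁻¹ * (p + p * (p - 1) / 2)) * (9 / 5 / κ) * Rp := by positivity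
  have hP2 : 0 ≤ 8 * Real.exp 35 * (κ⁻¹ + 4) * (Real.log n + 1) * R := by positivity
  have hγ0 : 0 < γ := by linarith
  refine orliczNormW_le _ _ hγ0 (sum_youngFun_norm_le_one hα0 hα1 hB.le
    (hsq hκ1 (by linarith) (by linarith)) (hsq hκ2 hα0 hα1) hp
    (fun x => norm_nonneg (f x - m)) hγ0 ?_ fun u hu => ?_)
  · have h := mul_le_mul_of_nonneg_left (sum_norm_sub_mean_le hκ hκ1 hκ2 f)
      (by positivity : 0 ≤ 8 * Real.exp 35)
    linarith
  · have h := mul_le_mul_of_nonneg_left (sum_upGrad_rpow_le hκ hκ1 hκ2 f m hu hp)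
      (by positivity : 0 ≤ 192 * κ⁻¹ * (p + p * (p - 1) / 2))
    linarith
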